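/- Let p ∈ (0,1) and let (G_t)_{t≥1} be the preferential attachment process with edge-steps with parameter p. Then for every ε with 0 < ε < 1, P( t^{(1−ε)(1−p)/(2−p)} ≤ ω(G_t) ≤ t^{(1−p)/(2−p)} · (log t)³ ) = 1 − o(1) as t → ∞, where ω(G_t) denotes the clique number of G_t. -/

import Mathlib

open MeasureTheory Filter

attribute [local instance] Classical.propDecidable

/-- Degree of vertex `i` at time `t` computed from the endpoint process `ep`:
the edge added at step `s` contributes `1` for each of its endpoints equal to `i`
(so a loop at `i` contributes `2`). -/
noncomputable def degOf {Ω : Type} (ep : ℕ → Ω → ℕ × ℕ) (t i : ℕ) (ω : Ω) : ℕ :=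
  ∑ s ∈ Finset.Icc 1 t,
    ((if (ep s ω).1 = i then 1 else 0) + (if (ep s ω).2 = i then 1 else 0))

/-- The preferential attachment random graph process with edge-steps and parameter `p`.
`G_1` is a single vertex (labeled `1`) with a loop.  At each step `t + 1` (for `t ≥ 1`),
with probability `p` a vertex-step occurs: a new vertex `nv t + 1` is added together with an
edge to an old vertex `u`, chosen with probability `d_t(u) / (2t)`; with probability `1 - p`
an edge-step occurs: an edge `{u, w}` is added, where `u` and `w` are chosen independently,
each with probability proportional to its degree.  The field `ep t` records the (ordered pair
of) endpoints of the unique edge added at step `t`, `nv t` is the number of vertices of `G_t`,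
and `Z t` tells whether step `t` was a vertex-step.  The one-step conditional laws are
prescribed via conditional expectations with respect to a filtration `ℱ` to which the process
is adapted. -/
structure PAProcess (p : ℝ) where
  Ω : Type
  m0 : MeasurableSpace Ω
  μ : Measure Ω
  isProb : IsProbabilityMeasure μ
  ℱ : Filtration ℕ m0
  Z : ℕ → Ω → Bool
  nv : ℕ → Ω → ℕ
  ep : ℕ → Ω → ℕ × ℕ
  nv_one : ∀ ω, nv 1 ω = 1
  ep_one : ∀ ω, ep 1 ω = (1, 1)
  nv_succ : ∀ t, 1 ≤ t → ∀ ω, nv (t + 1) ω = nv t ω + (if Z (t + 1) ω then 1 else 0)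
  ep_vertexStep : ∀ t, 1 ≤ t → ∀ ω, Z (t + 1) ω = true →
    (ep (t + 1) ω).2 = nv t ω + 1 ∧ 1 ≤ (ep (t + 1) ω).1 ∧ (ep (t + 1) ω).1 ≤ nv t ω
  ep_edgeStep : ∀ t, 1 ≤ t → ∀ ω, Z (t + 1) ω = false →
    1 ≤ (ep (t + 1) ω).1 ∧ (ep (t + 1) ω).1 ≤ nv t ω ∧
    1 ≤ (ep (t + 1) ω).2 ∧ (ep (t + 1) ω).2 ≤ nv t ω
  Z_meas : ∀ t, Measurable[ℱ t] (Z t)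
  nv_meas : ∀ t, Measurable[ℱ t] (nv t)
  ep_meas : ∀ t, Measurable[ℱ t] (ep t)
  condLaw_Z : ∀ t, 1 ≤ t →
    μ[Set.indicator {ω | Z (t + 1) ω = true} (fun _ => (1 : ℝ)) | ℱ t] =ᵐ[μ] fun _ => p
  condLaw_vertex : ∀ t, 1 ≤ t → ∀ u,
    μ[Set.indicator {ω | Z (t + 1) ω = true ∧ ep (t + 1) ω = (u, nv t ω + 1)}
        (fun _ => (1 : ℝ)) | ℱ t]
      =ᵐ[μ] fun ω => p * (degOf ep t u ω : ℝ) / (2 * t)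
  condLaw_edge : ∀ t, 1 ≤ t → ∀ u w,
    μ[Set.indicator {ω | Z (t + 1) ω = false ∧ ep (t + 1) ω = (u, w)}
        (fun _ => (1 : ℝ)) | ℱ t]
      =ᵐ[μ] fun ω => (1 - p) * (degOf ep t u ω : ℝ) * (degOf ep t w ω : ℝ) / (2 * t) ^ 2

namespace PAProcess

variable {p : ℝ} (P : PAProcess p)

/-- degree `d_t(i)` of vertex `i` in `G_t` (`0` if `i` is not yet present). -/
noncomputable def deg (t i : ℕ) (ω : P.Ω) : ℕ := degOf P.ep t i ω

/-- `i` and `j` are joined by at least one edge in `G_t`. -/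
def Joined (t i j : ℕ) (ω : P.Ω) : Prop :=
  ∃ s ∈ Finset.Icc 1 t, P.ep s ω = (i, j) ∨ P.ep s ω = (j, i)

/-- number of triangles of `G_t`: sets of three distinct vertices pairwise joined by at
least one edge (counted without edge multiplicities). -/
noncomputable def triangles (t : ℕ) (ω : P.Ω) : ℕ :=
  ((Finset.Icc 1 t ×ˢ Finset.Icc 1 t ×ˢ Finset.Icc 1 t).filter
    (fun q => q.1 < q.2.1 ∧ q.2.1 < q.2.2 ∧ P.Joined t q.1 q.2.1 ω ∧
      P.Joined t q.1 q.2.2 ω ∧ P.Joined t q.2.1 q.2.2 ω)).card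

/-- number of cherries (paths of length 2) of `G_t`: unordered pairs of distinct edges of
`G_t` sharing a common endpoint.  The edges of `G_t` are indexed by their creation times
`1 ≤ s ≤ t`. -/
noncomputable def cherries (t : ℕ) (ω : P.Ω) : ℕ :=
  ((Finset.Icc 1 t ×ˢ Finset.Icc 1 t).filter
    (fun q => q.1 < q.2 ∧
      ((P.ep q.1 ω).1 = (P.ep q.2 ω).1 ∨ (P.ep q.1 ω).1 = (P.ep q.2 ω).2 ∨
       (P.ep q.1 ω).2 = (P.ep q.2 ω).1 ∨ (P.ep q.1 ω).2 = (P.ep q.2 ω).2))).card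

/-- global clustering coefficient of `G_t`. -/
noncomputable def clustering (t : ℕ) (ω : P.Ω) : ℝ :=
  3 * (P.triangles t ω : ℝ) / (P.cherries t ω : ℝ)

/-- clique number of `G_t`: the largest `k` such that `G_t` contains `k` distinct vertices
pairwise joined by at least one edge. -/
noncomputable def cliqueNum (t : ℕ) (ω : P.Ω) : ℕ :=
  sSup {k | ∃ S : Finset ℕ, S ⊆ Finset.Icc 1 (P.nv t ω) ∧ S.card = k ∧
    ∀ i ∈ S, ∀ j ∈ S, i ≠ j → P.Joined t i j ω}

/-- `Γ_t(j)`: the number of distinct vertices joined to `j` by at least one edge in `G_t`. -/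
noncomputable def nbrCount (t j : ℕ) (ω : P.Ω) : ℕ :=
  ((Finset.Icc 1 t).filter (fun i => P.Joined t i j ω)).card

/-- the time at which vertex `j` is added to the graph. -/
noncomputable def addTime (j : ℕ) (ω : P.Ω) : ℕ := sInf {t | P.nv t ω = j}

/-- at step `s` an edge joining `i` and `j` is added by an edge-step. -/
def EdgeStepEdge (s i j : ℕ) (ω : P.Ω) : Prop :=
  2 ≤ s ∧ P.Z s ω = false ∧ (P.ep s ω = (i, j) ∨ P.ep s ω = (j, i))

/-- at step `s` an edge joining `i` and `j` is added by a vertex-step. -/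
def VertexStepEdge (s i j : ℕ) (ω : P.Ω) : Prop :=
  2 ≤ s ∧ P.Z s ω = true ∧ (P.ep s ω = (i, j) ∨ P.ep s ω = (j, i))

/-- at step `s` vertex `j` is added by a vertex-step and its attaching edge connects it
to vertex `i`. -/
def AttachEdge (s i j : ℕ) (ω : P.Ω) : Prop :=
  2 ≤ s ∧ P.Z s ω = true ∧ P.ep s ω = (i, j) ∧ P.nv s ω = j

/-- `i` and `j` are joined in `G_t` by at least one edge created at an edge-step. -/
def EdgeJoined (t i j : ℕ) (ω : P.Ω) : Prop :=
  ∃ s ∈ Finset.Icc 1 t, P.EdgeStepEdge s i j ω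

/-- `i` and `j` are joined in `G_t` by at least one edge created at a vertex-step. -/
def VJoined (t i j : ℕ) (ω : P.Ω) : Prop :=
  ∃ s ∈ Finset.Icc 1 t, P.VertexStepEdge s i j ω

/-- `i` and `j` are joined in `G_t`, and exclusively by edges created at vertex-steps. -/
def OnlyVertexJoined (t i j : ℕ) (ω : P.Ω) : Prop :=
  P.Joined t i j ω ∧
    ∀ s ∈ Finset.Icc 1 t, (P.ep s ω = (i, j) ∨ P.ep s ω = (j, i)) → P.Z s ω = true

end PAProcess

theorem integral_le_of_condExp_step {Ω : Type*} {m m0 : MeasurableSpace Ω} (hm : m ≤ m0)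
    {μ : Measure Ω} [IsProbabilityMeasure μ] {X q A B M M' : Ω → ℝ} {K C : ℝ}
    (hX : Integrable X μ) (hc : μ[X|m] =ᵐ[μ] q)
    (hA : Integrable A μ) (hB : StronglyMeasurable[m] B) (hBC : ∀ ω, |B ω| ≤ C)
    (hM : Integrable M μ) (hM' : Integrable M' μ)
    (h1 : ∀ ω, M' ω ≤ A ω + B ω * X ω) (h2 : ∀ ω, A ω + B ω * q ω ≤ K * M ω) :
    ∫ ω, M' ω ∂μ ≤ K * ∫ ω, M ω ∂μ := by
  have hBX : Integrable (B * X) μ :=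
    hX.bdd_mul (hB.mono hm).aestronglyMeasurable (ae_of_all _ fun ω => by simpa using hBC ω)
  have hpull : μ[B * X|m] =ᵐ[μ] B * q := by
    filter_upwards [condExp_mul_of_stronglyMeasurable_left hB hBX hX, hc] with ω h h'
    rw [h, Pi.mul_apply, h', Pi.mul_apply]
  have hBq : Integrable (B * q) μ := integrable_condExp.congr hpull
  have hint : ∫ ω, (B * X) ω ∂μ = ∫ ω, (B * q) ω ∂μ := by
    rw [← integral_condExp hm, integral_congr_ae hpull]
  calc ∫ ω, M' ω ∂μ ≤ ∫ ω, (A ω + (B * X) ω) ∂μ := integral_mono hM' (hA.add hBX) h1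
    _ = ∫ ω, (A ω + (B * q) ω) ∂μ := by
        rw [integral_add hA hBX, integral_add hA hBq, hint]
    _ ≤ ∫ ω, K * M ω ∂μ := integral_mono (hA.add hBq) (hM.const_mul K) h2
    _ = K * ∫ ω, M ω ∂μ := integral_const_mul _ _

theorem exp_mul_le_of_mem_Icc {l x : ℝ} (hl : |l| ≤ 1 / 4) (hx0 : 0 ≤ x) (hx2 : x ≤ 2) :
    Real.exp (l * x) ≤ 1 + (l + 2 * l ^ 2) * x := by
  have h1 : |l * x| ≤ 1 := by
    rw [abs_mul, abs_of_nonneg hx0]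
    nlinarith [abs_nonneg l]
  have h2 := (abs_le.1 (Real.abs_exp_sub_one_sub_id_le h1)).2
  nlinarith [mul_nonneg (mul_nonneg hx0 (sub_nonneg.2 hx2)) (sq_nonneg l)]

theorem integral_exp_le {Ω : Type*} {m0 : MeasurableSpace Ω} {μ : Measure Ω}
    [IsProbabilityMeasure μ] (ℱ : Filtration ℕ m0) {X q Y g : ℕ → Ω → ℝ} {l k : ℕ → ℝ} {s : ℕ}
    {C : ℝ} (hX : ∀ r, s ≤ r → Measurable[ℱ (r + 1)] (X (r + 1)))
    (hX0 : ∀ r, s ≤ r → ∀ ω, 0 ≤ X (r + 1) ω) (hX2 : ∀ r, s ≤ r → ∀ ω, X (r + 1) ω ≤ 2)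
    (hc : ∀ r, s ≤ r → μ[X (r + 1)|ℱ r] =ᵐ[μ] q r)
    (hYs : ∀ ω, Y s ω = C)
    (hY : ∀ r, s ≤ r → ∀ ω, Y (r + 1) ω = Y r ω + X (r + 1) ω)
    (hg : ∀ r, s ≤ r → Measurable[ℱ r] (g r)) (hg0 : ∀ r, s ≤ r → ∀ ω, 0 ≤ g r ω)
    (hg1 : ∀ r, s ≤ r → ∀ ω, g r ω ≤ 1) (hg' : ∀ r, s ≤ r → ∀ ω, g (r + 1) ω ≤ g r ω)
    (hl : ∀ r, s ≤ r → |l r| ≤ 1 / 4)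
    (hstep : ∀ r, s ≤ r → ∀ ω, g r ω ≠ 0 →
      l (r + 1) * Y r ω + (l (r + 1) + 2 * l (r + 1) ^ 2) * q r ω ≤ l r * Y r ω + k r)
    {t : ℕ} (hst : s ≤ t) :
    Integrable (fun ω => g t ω * Real.exp (l t * Y t ω)) μ ∧
      ∫ ω, g t ω * Real.exp (l t * Y t ω) ∂μ ≤
        Real.exp (∑ r ∈ Finset.Ico s t, k r) * Real.exp (l s * C) := by
  have hYm : ∀ r, s ≤ r → Measurable[ℱ r] (Y r) := by
    intro r hr
    induction r, hr using Nat.le_induction with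
    | base => rw [show Y s = fun _ => C from funext hYs]; exact measurable_const
    | succ r hr ih =>
      rw [show Y (r + 1) = fun ω => Y r ω + X (r + 1) ω from funext (hY r hr)]
      exact (ih.mono (ℱ.mono r.le_succ) le_rfl).add (hX r hr)
  have hYb : ∀ r, s ≤ r → ∃ D, ∀ ω, |Y r ω| ≤ D := by
    intro r hr
    induction r, hr using Nat.le_induction with
    | base => exact ⟨|C|, fun ω => by rw [hYs]⟩
    | succ r hr ih =>
      obtain ⟨D, hD⟩ := ih
      refine ⟨D + 2, fun ω => ?_⟩
      rw [hY r hr]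
      have h1 := abs_le.1 (hD ω)
      have h2 := hX0 r hr ω
      have h3 := hX2 r hr ω
      rw [abs_le]; constructor <;> linarith
  have hbd : ∀ r, s ≤ r → ∀ a : ℝ, ∃ D, ∀ ω, |g r ω * Real.exp (a * Y r ω)| ≤ D := by
    intro r hr a
    obtain ⟨D, hD⟩ := hYb r hr
    refine ⟨Real.exp (|a| * D), fun ω => ?_⟩
    rw [abs_mul, abs_of_nonneg (hg0 r hr ω), Real.abs_exp]
    calc g r ω * Real.exp (a * Y r ω) ≤ 1 * Real.exp (a * Y r ω) := by
          gcongr; exact hg1 r hr ω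
      _ ≤ Real.exp (|a| * D) := by
          rw [one_mul, Real.exp_le_exp]
          calc a * Y r ω ≤ |a * Y r ω| := le_abs_self _
            _ = |a| * |Y r ω| := abs_mul _ _
            _ ≤ |a| * D := by gcongr; exact hD ω
  have hms : ∀ r, s ≤ r → ∀ a : ℝ,
      Measurable[ℱ r] (fun ω => g r ω * Real.exp (a * Y r ω)) := fun r hr a =>
    (hg r hr).mul (Real.measurable_exp.comp ((hYm r hr).const_mul a))
  have hin : ∀ r, s ≤ r → ∀ a : ℝ, Integrable (fun ω => g r ω * Real.exp (a * Y r ω)) μ := by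
    intro r hr a
    obtain ⟨D, hD⟩ := hbd r hr a
    exact Integrable.of_bound ((hms r hr a).mono (ℱ.le r) le_rfl).aestronglyMeasurable D
      (ae_of_all _ hD)
  refine ⟨hin t hst _, ?_⟩
  induction t, hst using Nat.le_induction with
  | base =>
    simp only [Finset.Ico_self, Finset.sum_empty, Real.exp_zero, one_mul, hYs]
    calc ∫ ω, g s ω * Real.exp (l s * C) ∂μ ≤ ∫ ω, Real.exp (l s * C) ∂μ := by
          apply integral_mono _ (integrable_const _)
          · intro ω
            exact mul_le_of_le_one_left (Real.exp_pos _).le (hg1 s le_rfl ω)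
          · simpa only [hYs] using hin s le_rfl (l s)
      _ = _ := by simp
  | succ r hr ih =>
    obtain ⟨D, hD⟩ := hbd r hr (l (r + 1))
    have key : ∫ ω, g (r + 1) ω * Real.exp (l (r + 1) * Y (r + 1) ω) ∂μ ≤
        Real.exp (k r) * ∫ ω, g r ω * Real.exp (l r * Y r ω) ∂μ := by
      refine integral_le_of_condExp_step (ℱ.le r) (X := X (r + 1)) (q := q r)
        (A := fun ω => g r ω * Real.exp (l (r + 1) * Y r ω))
        (B := fun ω => (g r ω * Real.exp (l (r + 1) * Y r ω)) * (l (r + 1) + 2 * l (r + 1) ^ 2))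
        (C := D * |l (r + 1) + 2 * l (r + 1) ^ 2|)
        ?_ (hc r hr) (hin r hr _) ?_ ?_ (hin r hr _) (hin (r + 1) (by omega) _) ?_ ?_
      · refine Integrable.of_bound ((hX r hr).mono (ℱ.le _) le_rfl).aestronglyMeasurable 2
          (ae_of_all _ fun ω => ?_)
        rw [Real.norm_eq_abs, abs_of_nonneg (hX0 r hr ω)]
        exact hX2 r hr ω
      · exact ((hms r hr _).mul_const _).stronglyMeasurable
      · intro ω
        rw [abs_mul]
        gcongr
        exact hD ω
      · intro ω
        have h1 := exp_mul_le_of_mem_Icc (hl (r + 1) (by omega)) (hX0 r hr ω) (hX2 r hr ω)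
        rw [hY r hr, mul_add, Real.exp_add]
        calc g (r + 1) ω * (Real.exp (l (r + 1) * Y r ω) * Real.exp (l (r + 1) * X (r + 1) ω))
            ≤ g r ω * (Real.exp (l (r + 1) * Y r ω) *
              (1 + (l (r + 1) + 2 * l (r + 1) ^ 2) * X (r + 1) ω)) := by
              have := hg' r hr ω
              have := hg0 r hr ω
              gcongr
          _ = _ := by ring
      · intro ω
        by_cases h0 : g r ω = 0
        · simp [h0]
        · have h1 := Real.add_one_le_exp ((l (r + 1) + 2 * l (r + 1) ^ 2) * q r ω)
          have h2 := hstep r hr ω h0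
          calc g r ω * Real.exp (l (r + 1) * Y r ω) +
                g r ω * Real.exp (l (r + 1) * Y r ω) * (l (r + 1) + 2 * l (r + 1) ^ 2) * q r ω
              = g r ω * (Real.exp (l (r + 1) * Y r ω) *
                ((l (r + 1) + 2 * l (r + 1) ^ 2) * q r ω + 1)) := by ring
            _ ≤ g r ω * (Real.exp (l (r + 1) * Y r ω) *
                Real.exp ((l (r + 1) + 2 * l (r + 1) ^ 2) * q r ω)) := by
                have := hg0 r hr ω
                gcongr
            _ ≤ g r ω * Real.exp (l r * Y r ω + k r) := by
                rw [← Real.exp_add]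
                have := hg0 r hr ω
                gcongr
            _ = _ := by rw [Real.exp_add]; ring
    rw [Finset.sum_Ico_succ_top hr, Real.exp_add]
    refine (key.trans (mul_le_mul_of_nonneg_left ih (Real.exp_pos (k r)).le)).trans_eq ?_
    ring

theorem measureReal_le_exp {Ω : Type*} {m0 : MeasurableSpace Ω} {μ : Measure Ω}
    [IsProbabilityMeasure μ] (ℱ : Filtration ℕ m0) {X q Y g : ℕ → Ω → ℝ} {l k : ℕ → ℝ} {s : ℕ}
    {C : ℝ} (hX : ∀ r, s ≤ r → Measurable[ℱ (r + 1)] (X (r + 1)))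
    (hX0 : ∀ r, s ≤ r → ∀ ω, 0 ≤ X (r + 1) ω) (hX2 : ∀ r, s ≤ r → ∀ ω, X (r + 1) ω ≤ 2)
    (hc : ∀ r, s ≤ r → μ[X (r + 1)|ℱ r] =ᵐ[μ] q r)
    (hYs : ∀ ω, Y s ω = C)
    (hY : ∀ r, s ≤ r → ∀ ω, Y (r + 1) ω = Y r ω + X (r + 1) ω)
    (hg : ∀ r, s ≤ r → Measurable[ℱ r] (g r)) (hg0 : ∀ r, s ≤ r → ∀ ω, 0 ≤ g r ω)
    (hg1 : ∀ r, s ≤ r → ∀ ω, g r ω ≤ 1) (hg' : ∀ r, s ≤ r → ∀ ω, g (r + 1) ω ≤ g r ω)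
    (hl : ∀ r, s ≤ r → |l r| ≤ 1 / 4)
    (hstep : ∀ r, s ≤ r → ∀ ω, g r ω ≠ 0 →
      l (r + 1) * Y r ω + (l (r + 1) + 2 * l (r + 1) ^ 2) * q r ω ≤ l r * Y r ω + k r)
    {t : ℕ} (hst : s ≤ t) {A : Set Ω} {z : ℝ} (hAg : ∀ ω ∈ A, g t ω = 1)
    (hAY : ∀ ω ∈ A, z ≤ l t * Y t ω) :
    μ.real A ≤ Real.exp (∑ r ∈ Finset.Ico s t, k r + l s * C - z) := by
  obtain ⟨h1, h2⟩ := integral_exp_le ℱ hX hX0 hX2 hc hYs hY hg hg0 hg1 hg' hl hstep hst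
  have h3 := mul_meas_ge_le_integral_of_nonneg (μ := μ)
    (ae_of_all _ fun ω => mul_nonneg (hg0 t hst ω) (Real.exp_pos (l t * Y t ω)).le) h1
    (Real.exp z)
  have h4 : μ.real A ≤ μ.real {ω | Real.exp z ≤ g t ω * Real.exp (l t * Y t ω)} := by
    refine measureReal_mono fun ω hω => ?_
    have h5 := hAY ω hω
    simp only [Set.mem_ofPred_eq, hAg ω hω, one_mul]
    gcongr
  rw [Real.exp_sub, Real.exp_add, le_div_iff₀' (Real.exp_pos z)]
  refine le_trans ?_ (h3.trans h2)
  gcongr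

namespace PAProcess

variable {p : ℝ} (P : PAProcess p)

instance : MeasurableSpace P.Ω := P.m0

instance : IsProbabilityMeasure P.μ := P.isProb

theorem nv_le_nv_succ {s : ℕ} (hs : 1 ≤ s) (ω : P.Ω) : P.nv s ω ≤ P.nv (s + 1) ω := by
  rw [P.nv_succ s hs]; omega

theorem nv_mono {s t : ℕ} (hs : 1 ≤ s) (hst : s ≤ t) (ω : P.Ω) : P.nv s ω ≤ P.nv t ω := by
  induction t, hst using Nat.le_induction with
  | base => rfl
  | succ r hr ih => exact ih.trans (P.nv_le_nv_succ (by omega) ω)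

theorem nv_le {t : ℕ} (ht : 1 ≤ t) (ω : P.Ω) : P.nv t ω ≤ t := by
  induction t, ht using Nat.le_induction with
  | base => rw [P.nv_one]
  | succ r hr ih =>
    rw [P.nv_succ r hr]
    split_ifs <;> omega

theorem ep_bounds {t : ℕ} (ht : 1 ≤ t) (ω : P.Ω) :
    1 ≤ (P.ep t ω).1 ∧ (P.ep t ω).1 ≤ P.nv t ω ∧ 1 ≤ (P.ep t ω).2 ∧
      (P.ep t ω).2 ≤ P.nv t ω := by
  obtain ⟨t, rfl⟩ : ∃ s, t = s + 1 := ⟨t - 1, by omega⟩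
  rcases Nat.eq_zero_or_pos t with rfl | h
  · simp [P.ep_one, P.nv_one]
  · have h3 := P.nv_succ t h ω
    cases hZ : P.Z (t + 1) ω with
    | true =>
      have h2 := P.ep_vertexStep t h ω hZ
      simp only [hZ, if_true] at h3
      omega
    | false =>
      have h2 := P.ep_edgeStep t h ω hZ
      simp only [hZ] at h3
      simp at h3
      omega

theorem degOf_succ (t i : ℕ) (ω : P.Ω) :
    degOf P.ep (t + 1) i ω = degOf P.ep t i ω +
      ((if (P.ep (t + 1) ω).1 = i then 1 else 0) + (if (P.ep (t + 1) ω).2 = i then 1 else 0)) :=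
  Finset.sum_Icc_succ_top (by omega) _

theorem degOf_mono {s t : ℕ} (hst : s ≤ t) (i : ℕ) (ω : P.Ω) :
    degOf P.ep s i ω ≤ degOf P.ep t i ω :=
  Finset.sum_le_sum_of_subset (Finset.Icc_subset_Icc_right hst)

theorem degOf_eq_zero {t i : ℕ} (h : t < i) (ω : P.Ω) : degOf P.ep t i ω = 0 := by
  refine Finset.sum_eq_zero fun s hs => ?_
  rw [Finset.mem_Icc] at hs
  have h1 := P.ep_bounds hs.1 ω
  have h2 := P.nv_le hs.1 ω
  rw [if_neg (by omega), if_neg (by omega), add_zero]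

theorem le_nv_of_degOf_pos {t i : ℕ} {ω : P.Ω} (h : 0 < degOf P.ep t i ω) :
    1 ≤ i ∧ i ≤ P.nv t ω := by
  by_contra hi
  refine h.ne' (Finset.sum_eq_zero fun s hs => ?_)
  rw [Finset.mem_Icc] at hs
  have h1 := P.ep_bounds hs.1 ω
  have h2 := P.nv_mono hs.1 hs.2 ω
  rw [if_neg (by omega), if_neg (by omega), add_zero]

/-- total degree at time `t` of the vertices with labels in `S`. -/
noncomputable def degSet (t : ℕ) (S : Finset ℕ) (ω : P.Ω) : ℝ :=
  ∑ i ∈ S, (degOf P.ep t i ω : ℝ)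

theorem degSet_succ (t : ℕ) (S : Finset ℕ) (ω : P.Ω) :
    P.degSet (t + 1) S ω = P.degSet t S ω +
      ((if (P.ep (t + 1) ω).1 ∈ S then 1 else 0) +
        (if (P.ep (t + 1) ω).2 ∈ S then 1 else 0)) := by
  simp only [degSet, degOf_succ, Nat.cast_add, Finset.sum_add_distrib, Nat.cast_ite, Nat.cast_one,
    Nat.cast_zero, Finset.sum_ite_eq]

theorem degSet_nonneg (t : ℕ) (S : Finset ℕ) (ω : P.Ω) : 0 ≤ P.degSet t S ω :=
  Finset.sum_nonneg fun _ _ => Nat.cast_nonneg _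

theorem degSet_singleton (t i : ℕ) (ω : P.Ω) : P.degSet t {i} ω = degOf P.ep t i ω :=
  Finset.sum_singleton _ _

theorem degSet_Icc {n t : ℕ} (h : t ≤ n) (ω : P.Ω) : P.degSet t (Finset.Icc 1 n) ω = 2 * t := by
  induction t with
  | zero => simp [degSet, degOf]
  | succ t ih =>
    have h1 := P.ep_bounds (t := t + 1) (by omega) ω
    have h2 := P.nv_le (t := t + 1) (by omega) ω
    rw [degSet_succ, ih (by omega), if_pos (Finset.mem_Icc.2 (by omega)),
      if_pos (Finset.mem_Icc.2 (by omega))]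
    push_cast
    ring

theorem measurable_degOf {s t : ℕ} (hst : s ≤ t) (i : ℕ) :
    Measurable[P.ℱ t] (fun ω => (degOf P.ep s i ω : ℝ)) := by
  unfold degOf
  push_cast
  refine Finset.measurable_sum _ fun r hr => ?_
  have h1 : Measurable[P.ℱ t] (P.ep r) :=
    (P.ep_meas r).mono (P.ℱ.mono ((Finset.mem_Icc.1 hr).2.trans hst)) le_rfl
  exact (Measurable.of_discrete
    (f := fun e : ℕ × ℕ => (if e.1 = i then (1 : ℝ) else 0) + (if e.2 = i then (1 : ℝ) else 0))).comp
      h1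

/-- indicator that step `t` is a vertex-step whose new edge is attached to `S`. -/
noncomputable def vertexInd (S : Finset ℕ) (t : ℕ) : P.Ω → ℝ :=
  Set.indicator {ω | P.Z t ω = true ∧ (P.ep t ω).1 ∈ S} (fun _ => (1 : ℝ))

/-- indicator that step `t` is an edge-step whose ordered edge lies in `S × W`. -/
noncomputable def edgeInd (S W : Finset ℕ) (t : ℕ) : P.Ω → ℝ :=
  Set.indicator {ω | P.Z t ω = false ∧ (P.ep t ω).1 ∈ S ∧ (P.ep t ω).2 ∈ W} (fun _ => (1 : ℝ))

theorem measurable_vertexInd (S : Finset ℕ) (t : ℕ) : Measurable[P.ℱ t] (P.vertexInd S t) :=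
  (Measurable.of_discrete (f := Set.indicator {x : Bool × ℕ × ℕ | x.1 = true ∧ x.2.1 ∈ S}
    (fun _ => (1 : ℝ)))).comp
      ((P.Z_meas t).prodMk (P.ep_meas t))

theorem measurable_edgeInd (S W : Finset ℕ) (t : ℕ) : Measurable[P.ℱ t] (P.edgeInd S W t) :=
  (Measurable.of_discrete (f := Set.indicator
    {x : Bool × ℕ × ℕ | x.1 = false ∧ x.2.1 ∈ S ∧ x.2.2 ∈ W} (fun _ => (1 : ℝ)))).comp
      ((P.Z_meas t).prodMk (P.ep_meas t))

theorem integrable_vertexInd (S : Finset ℕ) (t : ℕ) : Integrable (P.vertexInd S t) P.μ := by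
  refine Integrable.of_bound ((P.measurable_vertexInd S t).mono
    (P.ℱ.le t) le_rfl).aestronglyMeasurable 1 (ae_of_all _ fun ω => ?_)
  unfold vertexInd Set.indicator
  split_ifs <;> simp

theorem integrable_edgeInd (S W : Finset ℕ) (t : ℕ) : Integrable (P.edgeInd S W t) P.μ := by
  refine Integrable.of_bound ((P.measurable_edgeInd S W t).mono
    (P.ℱ.le t) le_rfl).aestronglyMeasurable 1 (ae_of_all _ fun ω => ?_)
  unfold edgeInd Set.indicator
  split_ifs <;> simp

theorem condExp_vertexInd {t : ℕ} (ht : 1 ≤ t) (S : Finset ℕ) :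
    P.μ[P.vertexInd S (t + 1)|P.ℱ t] =ᵐ[P.μ] fun ω => p * P.degSet t S ω / (2 * t) := by
  have hind : P.vertexInd S (t + 1) = ∑ u ∈ S,
      Set.indicator {ω | P.Z (t + 1) ω = true ∧ P.ep (t + 1) ω = (u, P.nv t ω + 1)}
        (fun _ => (1 : ℝ)) := by
    funext ω
    rw [Finset.sum_apply]
    simp only [vertexInd, Set.indicator, Set.mem_ofPred_eq]
    cases hZ : P.Z (t + 1) ω with
    | true =>
      have h2 := (P.ep_vertexStep t ht ω hZ).1
      simp [Prod.ext_iff, h2]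
    | false => simp
  have hsum := condExp_finsetSum (μ := P.μ) (s := S) (f := fun u =>
      Set.indicator {ω | P.Z (t + 1) ω = true ∧ P.ep (t + 1) ω = (u, P.nv t ω + 1)}
        (fun _ => (1 : ℝ))) (fun u _ => ?_) (P.ℱ t)
  · rw [hind]
    have hall := (Finset.eventually_all S).2 fun u _ => P.condLaw_vertex t ht u
    filter_upwards [hsum, hall] with ω h1 h2
    rw [h1, Finset.sum_apply, Finset.sum_congr rfl h2, degSet, Finset.mul_sum, Finset.sum_div]
  · refine (integrable_const (1 : ℝ)).indicator ?_
    have h1 : Measurable (fun ω => (P.Z (t + 1) ω, P.ep (t + 1) ω, P.nv t ω)) :=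
      ((P.Z_meas (t + 1)).mono (P.ℱ.le _) le_rfl).prodMk
        (((P.ep_meas (t + 1)).mono (P.ℱ.le _) le_rfl).prodMk
          ((P.nv_meas t).mono (P.ℱ.le _) le_rfl))
    exact h1 (MeasurableSet.of_discrete
      (s := {x : Bool × (ℕ × ℕ) × ℕ | x.1 = true ∧ x.2.1 = (u, x.2.2 + 1)}))

theorem condExp_edgeInd {t : ℕ} (ht : 1 ≤ t) (S W : Finset ℕ) :
    P.μ[P.edgeInd S W (t + 1)|P.ℱ t] =ᵐ[P.μ]
      fun ω => (1 - p) * P.degSet t S ω * P.degSet t W ω / (2 * t) ^ 2 := by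
  have hind : P.edgeInd S W (t + 1) = ∑ x ∈ S ×ˢ W,
      Set.indicator {ω | P.Z (t + 1) ω = false ∧ P.ep (t + 1) ω = (x.1, x.2)}
        (fun _ => (1 : ℝ)) := by
    funext ω
    rw [Finset.sum_apply]
    simp only [edgeInd, Set.indicator, Set.mem_ofPred_eq]
    cases hZ : P.Z (t + 1) ω with
    | true => simp
    | false => simp [Finset.mem_product]
  have hsum := condExp_finsetSum (μ := P.μ) (s := S ×ˢ W) (f := fun x =>
      Set.indicator {ω | P.Z (t + 1) ω = false ∧ P.ep (t + 1) ω = (x.1, x.2)}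
        (fun _ => (1 : ℝ))) (fun u _ => ?_) (P.ℱ t)
  · rw [hind]
    have hall := (Finset.eventually_all (S ×ˢ W)).2 fun x _ => P.condLaw_edge t ht x.1 x.2
    filter_upwards [hsum, hall] with ω h1 h2
    rw [h1, Finset.sum_apply, Finset.sum_congr rfl h2, degSet, degSet, mul_assoc,
      Finset.sum_mul_sum, Finset.sum_product, Finset.mul_sum, Finset.sum_div]
    refine Finset.sum_congr rfl fun i _ => ?_
    rw [Finset.mul_sum, Finset.sum_div]
    refine Finset.sum_congr rfl fun j _ => ?_
    ring
  · refine (integrable_const (1 : ℝ)).indicator ?_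
    have h1 : Measurable (fun ω => (P.Z (t + 1) ω, P.ep (t + 1) ω)) :=
      ((P.Z_meas (t + 1)).mono (P.ℱ.le _) le_rfl).prodMk
        ((P.ep_meas (t + 1)).mono (P.ℱ.le _) le_rfl)
    exact h1 (MeasurableSet.of_discrete
      (s := {x : Bool × (ℕ × ℕ) | x.1 = false ∧ x.2 = (u.1, u.2)}))

end PAProcess

/-- `∏_{1 ≤ r < s} (1 + c / r)`, which is of order `s ^ c`. -/
noncomputable def growth (c : ℝ) (s : ℕ) : ℝ := ∏ r ∈ Finset.Ico 1 s, (1 + c / r)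

theorem growth_one (c : ℝ) : growth c 1 = 1 := by simp [growth]

theorem growth_succ (c : ℝ) {s : ℕ} (hs : 1 ≤ s) :
    growth c (s + 1) = growth c s * (1 + c / s) :=
  Finset.prod_Ico_succ_top hs _

theorem growth_pos {c : ℝ} (hc : 0 ≤ c) (s : ℕ) : 0 < growth c s :=
  Finset.prod_pos fun r _ => by positivity

theorem growth_mono {c : ℝ} (hc : 0 ≤ c) {s t : ℕ} (hs : 1 ≤ s) (hst : s ≤ t) :
    growth c s ≤ growth c t := by
  induction t, hst using Nat.le_induction with
  | base => rfl
  | succ r hr ih =>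
    rw [growth_succ c (hs.trans hr)]
    exact ih.trans (le_mul_of_one_le_right (growth_pos hc r).le
      (le_add_of_nonneg_right (by positivity)))

theorem rpow_le_growth {c : ℝ} (hc0 : 0 ≤ c) (hc1 : c ≤ 1) {s : ℕ} (hs : 1 ≤ s) :
    (s : ℝ) ^ c ≤ growth c s := by
  induction s, hs using Nat.le_induction with
  | base => simp [growth_one]
  | succ r hr ih =>
    have hr0 : (0 : ℝ) < r := by exact_mod_cast hr
    have h1 : (1 + 1 / (r : ℝ)) ^ c ≤ 1 + c * (1 / r) :=
      rpow_one_add_le_one_add_mul_self (by linarith [one_div_pos.2 hr0]) hc0 hc1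
    rw [growth_succ c hr]
    calc ((r + 1 : ℕ) : ℝ) ^ c = (r * (1 + 1 / (r : ℝ))) ^ c := by
          congr 1; push_cast; field_simp
      _ = (r : ℝ) ^ c * (1 + 1 / (r : ℝ)) ^ c := Real.mul_rpow hr0.le (by positivity)
      _ ≤ growth c r * (1 + c * (1 / r)) := by
          have := growth_pos hc0 r
          gcongr
      _ = _ := by ring

theorem rpow_le_rpow_mul_one_sub {y : ℝ} (hy0 : 0 ≤ y) (hy1 : y ≤ 1) (n : ℕ) :
    (n : ℝ) ^ y ≤ ((n + 1 : ℕ) : ℝ) ^ y * (1 - y / (n + 1)) := by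
  have hn : (0 : ℝ) < n + 1 := by positivity
  have h1 : (1 + -(1 / ((n : ℝ) + 1))) ^ y ≤ 1 + y * -(1 / ((n : ℝ) + 1)) := by
    refine rpow_one_add_le_one_add_mul_self ?_ hy0 hy1
    rw [neg_le_neg_iff, div_le_one hn]
    linarith [n.cast_nonneg (α := ℝ)]
  have h2 : 1 + -(1 / ((n : ℝ) + 1)) = n / (n + 1) := by field_simp; ring
  calc (n : ℝ) ^ y = ((n + 1) * (n / (n + 1) : ℝ)) ^ y := by congr 1; field_simp
    _ = ((n : ℝ) + 1) ^ y * (n / (n + 1) : ℝ) ^ y := Real.mul_rpow hn.le (by positivity)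
    _ ≤ ((n : ℝ) + 1) ^ y * (1 + y * -(1 / ((n : ℝ) + 1))) := by
        rw [← h2]; gcongr
    _ = _ := by push_cast; ring

theorem growth_le_rpow {c : ℝ} (hc0 : 0 ≤ c) (hc1 : c ≤ 1) {s : ℕ} (hs : 1 ≤ s) :
    growth c s ≤ 2 * (s : ℝ) ^ c := by
  have key : ∀ r : ℕ, 1 ≤ r → growth c (r + 1) ≤ 2 * (r : ℝ) ^ c := by
    intro r hr
    induction r, hr using Nat.le_induction with
    | base =>
      rw [growth_succ c le_rfl, growth_one]
      simp
      linarith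
    | succ r hr ih =>
      have h1 := rpow_le_rpow_mul_one_sub hc0 hc1 r
      have hx0 : 0 ≤ c / ((r : ℝ) + 1) := by positivity
      have hp : (0 : ℝ) ≤ ((r + 1 : ℕ) : ℝ) ^ c := by positivity
      rw [growth_succ c (by omega)]
      calc growth c (r + 1) * (1 + c / ((r + 1 : ℕ) : ℝ))
          ≤ (2 * (((r + 1 : ℕ) : ℝ) ^ c * (1 - c / (r + 1)))) * (1 + c / ((r : ℝ) + 1)) := by
            push_cast at h1 ⊢
            gcongr
            exact ih.trans (by gcongr)
        _ = 2 * ((r + 1 : ℕ) : ℝ) ^ c * (1 - (c / ((r : ℝ) + 1)) ^ 2) := by ring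
        _ ≤ 2 * ((r + 1 : ℕ) : ℝ) ^ c * 1 := by
            gcongr
            linarith [sq_nonneg (c / ((r : ℝ) + 1))]
        _ = _ := mul_one _
  rcases hs.eq_or_lt with rfl | h
  · simp [growth_one]
  · obtain ⟨r, rfl⟩ : ∃ r, s = r + 1 := ⟨s - 1, by omega⟩
    refine (key r (by omega)).trans ?_
    gcongr
    simp

theorem sum_rpow_neg_le {y : ℝ} (hy0 : 0 < y) (hy1 : y ≤ 1) (n : ℕ) :
    ∑ j ∈ Finset.Icc 1 n, (j : ℝ) ^ (y - 1) ≤ (n : ℝ) ^ y / y := by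
  induction n with
  | zero => simp [hy0.ne']
  | succ n ih =>
    rw [Finset.sum_Icc_succ_top (by omega)]
    have h1 := rpow_le_rpow_mul_one_sub hy0.le hy1 n
    have h2 : (((n + 1 : ℕ) : ℝ)) ^ (y - 1) = ((n + 1 : ℕ) : ℝ) ^ y / (n + 1) := by
      rw [Real.rpow_sub_one (by positivity)]; push_cast; rfl
    rw [h2]
    calc _ ≤ (n : ℝ) ^ y / y + ((n + 1 : ℕ) : ℝ) ^ y / (n + 1) := by gcongr
      _ ≤ ((n + 1 : ℕ) : ℝ) ^ y * (1 - y / (n + 1)) / y + ((n + 1 : ℕ) : ℝ) ^ y / (n + 1) := by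
          gcongr
      _ = _ := by field_simp; ring

theorem growth_rate_step {c v w a : ℝ} (hc : 0 ≤ c) (ha : 0 < a) {s : ℕ}
    (hs : 1 ≤ s) (hw : 2 * (v + w / (a * (1 + c / s))) ^ 2 ≤ w) :
    (v + w / (a * (1 + c / s))) / (a * (1 + c / s)) +
      ((v + w / (a * (1 + c / s))) / (a * (1 + c / s)) +
        2 * ((v + w / (a * (1 + c / s))) / (a * (1 + c / s))) ^ 2) * (c / s) ≤
      (v + w / a) / a := by
  have hx : 0 ≤ c / s := by positivity
  generalize c / (s : ℝ) = x at *
  generalize hu : v + w / (a * (1 + x)) = u at *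
  have h1 : v = u - w / (a * (1 + x)) := by linarith
  have h2 : (v + w / a) / a - (u / (a * (1 + x)) + (u / (a * (1 + x)) +
      2 * (u / (a * (1 + x))) ^ 2) * x) =
      x / (a ^ 2 * (1 + x) ^ 2) * ((w - 2 * u ^ 2) + w * x) := by
    rw [h1]
    have : 1 + x ≠ 0 := by positivity
    field_simp
    ring
  have h3 : 0 ≤ w := le_trans (by positivity) hw
  have h4 : 0 ≤ x / (a ^ 2 * (1 + x) ^ 2) * ((w - 2 * u ^ 2) + w * x) := by
    have : 0 ≤ w - 2 * u ^ 2 := by linarith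
    positivity
  linarith

namespace PAProcess

variable {p : ℝ} (P : PAProcess p)

/-- number of endpoints in `S` chosen preferentially at step `t`. -/
noncomputable def degInc (S : Finset ℕ) (t : ℕ) : P.Ω → ℝ :=
  P.vertexInd S t + P.edgeInd S (Finset.Icc 1 t) t + P.edgeInd (Finset.Icc 1 t) S t

theorem measurable_degInc (S : Finset ℕ) (t : ℕ) : Measurable[P.ℱ t] (P.degInc S t) :=
  ((P.measurable_vertexInd S t).add (P.measurable_edgeInd _ _ t)).add
    (P.measurable_edgeInd _ _ t)

theorem degInc_eq {t : ℕ} (ht : 1 ≤ t) (S : Finset ℕ) (ω : P.Ω) :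
    P.degInc S t ω = (if (P.ep t ω).1 ∈ S then 1 else 0) +
      (if P.Z t ω = false ∧ (P.ep t ω).2 ∈ S then 1 else 0) := by
  have h1 := P.ep_bounds ht ω
  have h2 := P.nv_le ht ω
  have h3 : (P.ep t ω).1 ∈ Finset.Icc 1 t := Finset.mem_Icc.2 (by omega)
  have h4 : (P.ep t ω).2 ∈ Finset.Icc 1 t := Finset.mem_Icc.2 (by omega)
  simp only [degInc, vertexInd, edgeInd, Set.indicator, Pi.add_apply, Set.mem_ofPred_eq]
  cases hZ : P.Z t ω <;> simp only [h3, h4] <;> simp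

theorem degInc_nonneg {t : ℕ} (ht : 1 ≤ t) (S : Finset ℕ) (ω : P.Ω) : 0 ≤ P.degInc S t ω := by
  rw [P.degInc_eq ht]; positivity

theorem degInc_le_two {t : ℕ} (ht : 1 ≤ t) (S : Finset ℕ) (ω : P.Ω) : P.degInc S t ω ≤ 2 := by
  rw [P.degInc_eq ht]
  split_ifs <;> norm_num

theorem condExp_degInc {t : ℕ} (ht : 1 ≤ t) (S : Finset ℕ) :
    P.μ[P.degInc S (t + 1)|P.ℱ t] =ᵐ[P.μ] fun ω => (1 - p / 2) * P.degSet t S ω / t := by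
  have hv := P.integrable_vertexInd S (t + 1)
  have he := P.integrable_edgeInd S (Finset.Icc 1 (t + 1)) (t + 1)
  have he' := P.integrable_edgeInd (Finset.Icc 1 (t + 1)) S (t + 1)
  have ht0 : (t : ℝ) ≠ 0 := by positivity
  filter_upwards [condExp_add (hv.add he) he' (P.ℱ t), condExp_add hv he (P.ℱ t),
    P.condExp_vertexInd ht S, P.condExp_edgeInd ht S (Finset.Icc 1 (t + 1)),
    P.condExp_edgeInd ht (Finset.Icc 1 (t + 1)) S] with ω h1 h2 h3 h4 h5
  rw [degInc, h1, Pi.add_apply, h2, Pi.add_apply, h3, h4, h5, P.degSet_Icc t.le_succ]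
  field_simp
  ring

theorem degSet_add_degInc_le {t : ℕ} (S : Finset ℕ) (ω : P.Ω) :
    P.degSet t S ω + P.degInc S (t + 1) ω ≤ P.degSet (t + 1) S ω := by
  rw [P.degSet_succ, P.degInc_eq (by omega), add_le_add_iff_left, add_le_add_iff_left]
  split_ifs <;> simp_all

theorem degOf_le_add_sum_degInc {j r : ℕ} (hj : 1 ≤ j) (hr : j ≤ r) (ω : P.Ω) :
    (degOf P.ep r j ω : ℝ) ≤ 2 + ∑ s ∈ Finset.Ioc j r, P.degInc {j} s ω := by
  have hbase : degOf P.ep j j ω ≤ 2 := by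
    obtain ⟨i, rfl⟩ : ∃ i, j = i + 1 := ⟨j - 1, by omega⟩
    rw [P.degOf_succ, P.degOf_eq_zero i.lt_succ_self]
    split_ifs <;> simp
  have key : ∀ r, j ≤ r → (degOf P.ep r j ω : ℝ) ≤
      (if j ≤ P.nv r ω then 1 else 0) + 1 + ∑ s ∈ Finset.Ioc j r, P.degInc {j} s ω := by
    intro r hr
    induction r, hr using Nat.le_induction with
    | base =>
      rcases Nat.eq_zero_or_pos (degOf P.ep j j ω) with h | h
      · rw [h]
        simp
        positivity
      · have h' : (degOf P.ep j j ω : ℝ) ≤ 2 := by exact_mod_cast hbase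
        rw [if_pos (P.le_nv_of_degOf_pos h).2]
        simp
        linarith
    | succ r hr ih =>
      rw [← Finset.insert_Ioc_right_eq_Ioc_add_one hr, Finset.sum_insert (by simp),
        P.degOf_succ, P.degInc_eq (by omega), P.nv_succ r (by omega)]
      cases hZ : P.Z (r + 1) ω with
      | false =>
        simp only [hZ] at *
        push_cast
        simp
        linarith
      | true =>
        have h1 := P.ep_vertexStep r (by omega) ω hZ
        by_cases h2 : (P.ep (r + 1) ω).2 = j
        · have h3 : ¬ j ≤ P.nv r ω := by omega
          have h4 : j ≤ P.nv r ω + 1 := by omega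
          simp [h3] at ih
          simp [h2, h4]
          linarith
        · have h5 : (if j ≤ P.nv r ω then (1 : ℝ) else 0) ≤
              if j ≤ P.nv r ω + 1 then 1 else 0 := by
            split_ifs <;> first | omega | norm_num
          simp [h2]
          linarith
  refine (key r hr).trans ?_
  gcongr
  split_ifs <;> norm_num

theorem measureReal_le_degOf_le (hp1 : p ≤ 1) {j r : ℕ} (hj : 1 ≤ j) (hr : j ≤ r)
    {x : ℝ} (hx : 0 ≤ x) :
    P.μ.real {ω | x ≤ (degOf P.ep r j ω : ℝ)} ≤
      Real.exp (1 / 2 - x * growth (1 - p / 2) j / (8 * growth (1 - p / 2) r)) := by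
  have hc : 0 ≤ 1 - p / 2 := by linarith
  set a : ℕ → ℝ := growth (1 - p / 2) with ha
  have hpos : ∀ s, 0 < a s := growth_pos hc
  have hl0 : ∀ s, 0 ≤ (a j / 8 + a j ^ 2 / 8 / a s) / a s := fun s => by
    have := hpos s; have := hpos j; positivity
  have hu : ∀ s, j ≤ s → a j / 8 + a j ^ 2 / 8 / a s ≤ a j / 4 := fun s hs => by
    have h1 := growth_mono hc hj hs
    have h2 := hpos s
    have h3 : a j ^ 2 / 8 / a s ≤ a j / 8 := by
      rw [div_le_iff₀ h2]
      nlinarith [hpos j]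
    linarith
  have hw : ∀ s, j ≤ s → 2 * (a j / 8 + a j ^ 2 / 8 / a s) ^ 2 ≤ a j ^ 2 / 8 := fun s hs => by
    have h1 : 0 ≤ a j / 8 + a j ^ 2 / 8 / a s := by
      have := hpos s; have := hpos j; positivity
    nlinarith [hu s hs]
  have key := measureReal_le_exp P.ℱ (μ := P.μ) (s := j) (t := r) (X := P.degInc {j})
    (q := fun s ω => (1 - p / 2) * P.degSet s {j} ω / s)
    (Y := fun s ω => 2 + ∑ i ∈ Finset.Ioc j s, P.degInc {j} i ω) (g := fun _ _ => 1)
    (l := fun s => (a j / 8 + a j ^ 2 / 8 / a s) / a s) (k := fun _ => 0) (C := 2)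
    (A := {ω | x ≤ (degOf P.ep r j ω : ℝ)}) (z := x * a j / (8 * a r))
    (fun s _ => P.measurable_degInc _ _) (fun s _ => P.degInc_nonneg (by omega) _)
    (fun s _ => P.degInc_le_two (by omega) _)
    (fun s hs => P.condExp_degInc (by omega) _) (fun ω => by simp)
    (fun s hs ω => by
      rw [← Finset.insert_Ioc_right_eq_Ioc_add_one hs, Finset.sum_insert (by simp)]; ring)
    (fun s _ => measurable_const) (fun _ _ _ => zero_le_one) (fun _ _ _ => le_rfl)
    (fun _ _ _ => le_rfl) ?_ ?_ hr (fun _ _ => rfl) ?_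
  · refine key.trans_eq ?_
    have := (hpos j).ne'
    congr 1
    simp only [Finset.sum_const_zero]
    field_simp
    ring
  · intro s hs
    rw [abs_of_nonneg (hl0 s), div_le_iff₀ (hpos s)]
    have h1 : a j ≤ a s := growth_mono hc hj hs
    linarith [hu s hs]
  · intro s hs ω _
    have hs1 : 1 ≤ s := hj.trans hs
    have h1 := growth_rate_step (v := a j / 8) (w := a j ^ 2 / 8) hc (hpos s) hs1
      (by rw [ha, ← growth_succ _ hs1]; exact hw (s + 1) (by omega))
    rw [ha, ← growth_succ _ hs1, ← ha] at h1
    have h2 : P.degSet s {j} ω ≤ 2 + ∑ i ∈ Finset.Ioc j s, P.degInc {j} i ω := by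
      rw [P.degSet_singleton]
      exact P.degOf_le_add_sum_degInc hj hs ω
    have h3 := P.degSet_nonneg s {j} ω
    have h4 := hl0 (s + 1)
    set l := (a j / 8 + a j ^ 2 / 8 / a s) / a s
    set l' := (a j / 8 + a j ^ 2 / 8 / a (s + 1)) / a (s + 1)
    set Y := 2 + ∑ i ∈ Finset.Ioc j s, P.degInc {j} i ω
    calc l' * Y + (l' + 2 * l' ^ 2) * ((1 - p / 2) * P.degSet s {j} ω / s)
        ≤ l' * Y + (l' + 2 * l' ^ 2) * ((1 - p / 2) * Y / s) := by gcongr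
      _ = (l' + (l' + 2 * l' ^ 2) * ((1 - p / 2) / s)) * Y := by ring
      _ ≤ l * Y := by
          have : 0 ≤ Y := h3.trans h2
          gcongr
      _ = l * Y + 0 := (add_zero _).symm
  · intro ω hω
    have h1 : x ≤ 2 + ∑ i ∈ Finset.Ioc j r, P.degInc {j} i ω :=
      le_trans hω (P.degOf_le_add_sum_degInc hj hr ω)
    have h2 := hpos r
    have h3 := hpos j
    calc x * a j / (8 * a r) = a j / 8 / a r * x := by field_simp
      _ ≤ (a j / 8 + a j ^ 2 / 8 / a r) / a r * x := by
          gcongr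
          exact le_add_of_nonneg_right (by positivity)
      _ ≤ _ := by
          have := hl0 r
          gcongr

theorem measureReal_degSet_le (hp1 : p ≤ 1) {s t : ℕ} (hs : 1 ≤ s) (hst : s ≤ t) :
    P.μ.real {ω | P.degSet t (Finset.Icc 1 s) ω ≤
        s * growth (1 - p / 2) t / (2 * growth (1 - p / 2) s)} ≤ Real.exp (-(s / 8)) := by
  have hc : 0 ≤ 1 - p / 2 := by linarith
  set a : ℕ → ℝ := growth (1 - p / 2) with ha
  have hpos : ∀ s, 0 < a s := growth_pos hc
  have hmono : ∀ r, s ≤ r → a s ≤ a r := fun r hr => growth_mono hc hs hr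
  have hu0 : ∀ r, s ≤ r → -(a s / 4) + a s ^ 2 / 8 / a r ≤ 0 := fun r hr => by
    have h3 : a s ^ 2 / 8 / a r ≤ a s / 8 := by
      rw [div_le_iff₀ (hpos r)]
      nlinarith [hpos s, hmono r hr]
    linarith [hpos s]
  have hu1 : ∀ r, -(a s / 4) ≤ -(a s / 4) + a s ^ 2 / 8 / a r := fun r =>
    le_add_of_nonneg_right (by have := hpos r; positivity)
  have hw : ∀ r, s ≤ r → 2 * (-(a s / 4) + a s ^ 2 / 8 / a r) ^ 2 ≤ a s ^ 2 / 8 :=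
    fun r hr => by nlinarith [hu0 r hr, hu1 r]
  have hl0 : ∀ r, s ≤ r → (-(a s / 4) + a s ^ 2 / 8 / a r) / a r ≤ 0 := fun r hr =>
    div_nonpos_of_nonpos_of_nonneg (hu0 r hr) (hpos r).le
  have hl1 : ∀ r, s ≤ r → -(1 / 4) ≤ (-(a s / 4) + a s ^ 2 / 8 / a r) / a r := fun r hr => by
    rw [le_div_iff₀ (hpos r)]
    linarith [hu1 r, hmono r hr]
  have hY : ∀ r, s ≤ r → ∀ ω, 2 * (s : ℝ) + ∑ i ∈ Finset.Ioc s r,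
      P.degInc (Finset.Icc 1 s) i ω ≤ P.degSet r (Finset.Icc 1 s) ω := by
    intro r hr ω
    induction r, hr using Nat.le_induction with
    | base => simp [P.degSet_Icc le_rfl]
    | succ r hr ih =>
      rw [← Finset.insert_Ioc_right_eq_Ioc_add_one hr, Finset.sum_insert (by simp)]
      linarith [P.degSet_add_degInc_le (t := r) (Finset.Icc 1 s) ω]
  have hY0 : ∀ r, s ≤ r → ∀ ω, 0 ≤ 2 * (s : ℝ) + ∑ i ∈ Finset.Ioc s r,
      P.degInc (Finset.Icc 1 s) i ω := fun r hr ω =>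
    add_nonneg (by positivity) (Finset.sum_nonneg fun i hi =>
      P.degInc_nonneg (by have := (Finset.mem_Ioc.1 hi).1; omega) _ _)
  have key := measureReal_le_exp P.ℱ (μ := P.μ) (s := s) (t := t) (X := P.degInc (Finset.Icc 1 s))
    (q := fun r ω => (1 - p / 2) * P.degSet r (Finset.Icc 1 s) ω / r)
    (Y := fun r ω => 2 * (s : ℝ) + ∑ i ∈ Finset.Ioc s r, P.degInc (Finset.Icc 1 s) i ω)
    (g := fun _ _ => 1)
    (l := fun r => (-(a s / 4) + a s ^ 2 / 8 / a r) / a r) (k := fun _ => 0) (C := 2 * s)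
    (A := {ω | P.degSet t (Finset.Icc 1 s) ω ≤ s * a t / (2 * a s)})
    (z := -(s / 8))
    (fun r _ => P.measurable_degInc _ _) (fun r _ => P.degInc_nonneg (by omega) _)
    (fun r _ => P.degInc_le_two (by omega) _)
    (fun r hr => P.condExp_degInc (by omega) _) (fun ω => by simp)
    (fun r hr ω => by
      rw [← Finset.insert_Ioc_right_eq_Ioc_add_one hr, Finset.sum_insert (by simp)]; ring)
    (fun r _ => measurable_const) (fun _ _ _ => zero_le_one) (fun _ _ _ => le_rfl)
    (fun _ _ _ => le_rfl) ?_ ?_ hst (fun _ _ => rfl) ?_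
  · refine key.trans_eq ?_
    have := (hpos s).ne'
    congr 1
    simp only [Finset.sum_const_zero]
    field_simp
    ring
  · intro r hr
    rw [abs_le]
    exact ⟨hl1 r hr, (hl0 r hr).trans (by norm_num)⟩
  · intro r hr ω _
    have hr1 : 1 ≤ r := hs.trans hr
    have h1 := growth_rate_step (v := -(a s / 4)) (w := a s ^ 2 / 8) hc (hpos r) hr1
      (by rw [ha, ← growth_succ _ hr1]; exact hw (r + 1) (by omega))
    rw [ha, ← growth_succ _ hr1, ← ha] at h1
    have h2 := hY r hr ω
    have h3 := hY0 r hr ω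
    have h4 := hl0 (r + 1) (by omega)
    have h5 := hl1 (r + 1) (by omega)
    set l := (-(a s / 4) + a s ^ 2 / 8 / a r) / a r
    set l' := (-(a s / 4) + a s ^ 2 / 8 / a (r + 1)) / a (r + 1)
    set Y := 2 * (s : ℝ) + ∑ i ∈ Finset.Ioc s r, P.degInc (Finset.Icc 1 s) i ω
    have h6 : l' + 2 * l' ^ 2 ≤ 0 := by nlinarith
    calc l' * Y + (l' + 2 * l' ^ 2) * ((1 - p / 2) * P.degSet r (Finset.Icc 1 s) ω / r)
        ≤ l' * Y + (l' + 2 * l' ^ 2) * ((1 - p / 2) * Y / r) := by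
          rw [add_le_add_iff_left]
          exact mul_le_mul_of_nonpos_left (by gcongr) h6
      _ = (l' + (l' + 2 * l' ^ 2) * ((1 - p / 2) / r)) * Y := by ring
      _ ≤ l * Y := by gcongr
      _ = l * Y + 0 := (add_zero _).symm
  · intro ω hω
    have h1 : 2 * (s : ℝ) + ∑ i ∈ Finset.Ioc s t, P.degInc (Finset.Icc 1 s) i ω ≤
      s * a t / (2 * a s) := (hY t hst ω).trans hω
    have h2 := hpos t
    have h3 := hpos s
    calc -((s : ℝ) / 8) = -(a s / 4) / a t * (s * a t / (2 * a s)) := by field_simp; norm_num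
      _ ≤ (-(a s / 4) + a s ^ 2 / 8 / a t) / a t * (s * a t / (2 * a s)) := by
          gcongr
          exact hu1 t
      _ ≤ _ := mul_le_mul_of_nonpos_left h1 (hl0 t hst)

/-- number of ordered edges between `i` and `W` (in either order) added by an edge-step at
step `t`. -/
noncomputable def edgeInc (i : ℕ) (W : Finset ℕ) (t : ℕ) : P.Ω → ℝ :=
  P.edgeInd {i} W t + P.edgeInd W {i} t

theorem measurable_edgeInc (i : ℕ) (W : Finset ℕ) (t : ℕ) : Measurable[P.ℱ t] (P.edgeInc i W t) :=
  (P.measurable_edgeInd _ _ t).add (P.measurable_edgeInd _ _ t)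

theorem edgeInd_nonneg (S W : Finset ℕ) (t : ℕ) (ω : P.Ω) : 0 ≤ P.edgeInd S W t ω :=
  Set.indicator_nonneg (fun _ _ => zero_le_one) _

theorem edgeInd_le_one (S W : Finset ℕ) (t : ℕ) (ω : P.Ω) : P.edgeInd S W t ω ≤ 1 :=
  Set.indicator_le_self' (fun _ _ => zero_le_one) _

theorem edgeInc_nonneg (i : ℕ) (W : Finset ℕ) (t : ℕ) (ω : P.Ω) : 0 ≤ P.edgeInc i W t ω :=
  add_nonneg (P.edgeInd_nonneg _ _ _ _) (P.edgeInd_nonneg _ _ _ _)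

theorem edgeInc_le_two (i : ℕ) (W : Finset ℕ) (t : ℕ) (ω : P.Ω) : P.edgeInc i W t ω ≤ 2 :=
  (add_le_add (P.edgeInd_le_one _ _ _ _) (P.edgeInd_le_one _ _ _ _)).trans (by norm_num)

theorem condExp_edgeInc {t : ℕ} (ht : 1 ≤ t) (i : ℕ) (W : Finset ℕ) :
    P.μ[P.edgeInc i W (t + 1)|P.ℱ t] =ᵐ[P.μ]
      fun ω => (1 - p) * degOf P.ep t i ω * P.degSet t W ω / (2 * t ^ 2) := by
  have he := P.integrable_edgeInd {i} W (t + 1)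
  have he' := P.integrable_edgeInd W {i} (t + 1)
  filter_upwards [condExp_add he he' (P.ℱ t), P.condExp_edgeInd ht {i} W,
    P.condExp_edgeInd ht W {i}] with ω h1 h2 h3
  rw [edgeInc, h1, Pi.add_apply, h2, h3, P.degSet_singleton]
  have ht0 : (t : ℝ) ≠ 0 := by positivity
  field_simp
  ring

/-- up to time `r`, the degree of each vertex `j ≤ n` is at most `x` times its typical size. -/
def degBounded (x : ℝ) (n r : ℕ) : Set P.Ω :=
  {ω | ∀ s ∈ Finset.Icc 1 r, ∀ j ∈ Finset.Icc 1 n,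
    (degOf P.ep s j ω : ℝ) ≤ x * growth (1 - p / 2) s / growth (1 - p / 2) j}

theorem measurableSet_degBounded (x : ℝ) (n r : ℕ) :
    MeasurableSet[P.ℱ r] (P.degBounded x n r) := by
  have h : P.degBounded x n r = ⋂ s ∈ Finset.Icc 1 r, ⋂ j ∈ Finset.Icc 1 n,
      {ω | (degOf P.ep s j ω : ℝ) ≤ x * growth (1 - p / 2) s / growth (1 - p / 2) j} := by
    ext ω
    simp only [degBounded, Set.mem_iInter, Set.mem_ofPred_eq]
  rw [h]
  refine Finset.measurableSet_biInter _ fun s hs => Finset.measurableSet_biInter _ fun j _ => ?_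
  exact P.measurable_degOf (Finset.mem_Icc.1 hs).2 j measurableSet_Iic

theorem degBounded_antitone (x : ℝ) (n : ℕ) {r r' : ℕ} (h : r ≤ r') :
    P.degBounded x n r' ⊆ P.degBounded x n r :=
  fun _ hω s hs => hω s (Finset.Icc_subset_Icc_right h hs)

theorem measureReal_compl_degBounded_le (hp1 : p ≤ 1) {x : ℝ} (hx : 0 ≤ x) (n : ℕ) :
    P.μ.real (P.degBounded x n n)ᶜ ≤ (n : ℝ) ^ 2 * Real.exp (1 / 2 - x / 8) := by
  have hc : 0 ≤ 1 - p / 2 := by linarith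
  have hsub : (P.degBounded x n n)ᶜ ⊆ ⋃ e ∈ Finset.Icc 1 n ×ˢ Finset.Icc 1 n,
      {ω | e.2 ≤ e.1 ∧ x * growth (1 - p / 2) e.1 / growth (1 - p / 2) e.2 ≤
        (degOf P.ep e.1 e.2 ω : ℝ)} := by
    intro ω hω
    simp only [degBounded, Set.mem_compl_iff, Set.mem_ofPred_eq, not_forall, not_le] at hω
    obtain ⟨s, hs, j, hj, h⟩ := hω
    simp only [Set.mem_iUnion]
    refine ⟨(s, j), Finset.mem_product.2 ⟨hs, hj⟩, ?_, h.le⟩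
    by_contra hsj
    rw [P.degOf_eq_zero (not_le.1 hsj)] at h
    have h1 := growth_pos hc s
    have h2 := growth_pos hc j
    have : 0 ≤ x * growth (1 - p / 2) s / growth (1 - p / 2) j := by positivity
    simp at h
    linarith
  refine (measureReal_mono hsub (measure_ne_top _ _)).trans
    ((measureReal_biUnion_finset_le _ _).trans ?_)
  calc _ ≤ ∑ e ∈ Finset.Icc 1 n ×ˢ Finset.Icc 1 n, Real.exp (1 / 2 - x / 8) := by
        refine Finset.sum_le_sum fun e he => ?_
        obtain ⟨h1, h2⟩ := Finset.mem_product.1 he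
        rw [Finset.mem_Icc] at h1 h2
        by_cases h : e.2 ≤ e.1
        · have h3 := (growth_pos hc e.1)
          have h4 := (growth_pos hc e.2)
          refine (measureReal_mono fun ω hω => hω.2).trans
            ((P.measureReal_le_degOf_le hp1 h2.1 h
              (x := x * growth (1 - p / 2) e.1 / growth (1 - p / 2) e.2)
              (by positivity)).trans_eq ?_)
          congr 2
          generalize growth (1 - p / 2) e.1 = a at *
          generalize growth (1 - p / 2) e.2 = b at *
          field_simp
        · simp only [h, false_and]
          simp
          positivity
    _ = _ := by
        rw [Finset.sum_const, Finset.card_product, Nat.card_Icc]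
        simp [sq]

theorem measureReal_edgeInc_ge_le (hp0 : 0 < p) (hp1 : p < 1) {x : ℝ} (hx : 0 ≤ x) {n i : ℕ}
    (hi : 1 ≤ i) (hin : i ≤ n) (z : ℝ) :
    P.μ.real {ω | ω ∈ P.degBounded x n n ∧
        z ≤ ∑ s ∈ Finset.Ioc 1 n, P.edgeInc i (Finset.Icc 1 (i - 1)) s ω} ≤
      Real.exp (3 / (2 * p * (1 - p)) * x ^ 2 * ((n : ℝ) / i) ^ (1 - p) - z / 4) := by
  have hc0 : 0 ≤ 1 - p / 2 := by linarith
  have hc1 : 1 - p / 2 ≤ 1 := by linarith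
  have hi0 : (0 : ℝ) < i := by exact_mod_cast hi
  have hgpos : ∀ s, 0 < growth (1 - p / 2) s := growth_pos hc0
  have hdeg : ∀ r, 1 ≤ r → ∀ ω ∈ P.degBounded x n r, ∀ j ∈ Finset.Icc 1 n,
      (degOf P.ep r j ω : ℝ) ≤ 2 * x * (r : ℝ) ^ (1 - p / 2) * (j : ℝ) ^ (-(1 - p / 2)) := by
    intro r hr ω hω j hj
    have hj1 := (Finset.mem_Icc.1 hj).1
    have hj0 : (0 : ℝ) < (j : ℝ) ^ (1 - p / 2) := by
      have : (0 : ℝ) < j := by exact_mod_cast hj1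
      positivity
    refine (hω r (Finset.mem_Icc.2 ⟨hr, le_rfl⟩) j hj).trans ?_
    rw [Real.rpow_neg (by positivity), ← div_eq_mul_inv]
    calc x * growth (1 - p / 2) r / growth (1 - p / 2) j
        ≤ x * (2 * (r : ℝ) ^ (1 - p / 2)) / (j : ℝ) ^ (1 - p / 2) := by
          gcongr
          · exact growth_le_rpow hc0 hc1 hr
          · exact rpow_le_growth hc0 hc1 hj1
      _ = _ := by ring
  have hq : ∀ r, 1 ≤ r → ∀ ω ∈ P.degBounded x n r,
      (1 - p) * degOf P.ep r i ω * P.degSet r (Finset.Icc 1 (i - 1)) ω / (2 * r ^ 2) ≤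
        4 / p * x ^ 2 * (r : ℝ) ^ (-p) * (i : ℝ) ^ (p - 1) := by
    intro r hr ω hω
    have hr0 : (0 : ℝ) < r := by exact_mod_cast hr
    have h1 := hdeg r hr ω hω i (Finset.mem_Icc.2 ⟨hi, hin⟩)
    have h2 : P.degSet r (Finset.Icc 1 (i - 1)) ω ≤
        2 * x * (r : ℝ) ^ (1 - p / 2) * (2 / p * (i : ℝ) ^ (p / 2)) := by
      calc P.degSet r (Finset.Icc 1 (i - 1)) ω
          ≤ ∑ j ∈ Finset.Icc 1 (i - 1),
            2 * x * (r : ℝ) ^ (1 - p / 2) * (j : ℝ) ^ (p / 2 - 1) := by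
            refine Finset.sum_le_sum fun j hj => ?_
            rw [Finset.mem_Icc] at hj
            have := hdeg r hr ω hω j (Finset.mem_Icc.2 ⟨hj.1, by omega⟩)
            rwa [neg_sub] at this
        _ ≤ 2 * x * (r : ℝ) ^ (1 - p / 2) * (((i - 1 : ℕ) : ℝ) ^ (p / 2) / (p / 2)) := by
            rw [← Finset.mul_sum]
            gcongr
            exact sum_rpow_neg_le (by linarith) (by linarith) _
        _ ≤ 2 * x * (r : ℝ) ^ (1 - p / 2) * ((i : ℝ) ^ (p / 2) / (p / 2)) := by
            gcongr
            omega
        _ = _ := by field_simp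
    have h3 := P.degSet_nonneg r (Finset.Icc 1 (i - 1)) ω
    have e1 : (r : ℝ) ^ (1 - p / 2) * (r : ℝ) ^ (1 - p / 2) / r ^ 2 = (r : ℝ) ^ (-p) := by
      rw [← Real.rpow_add hr0, ← Real.rpow_natCast, ← Real.rpow_sub hr0]
      congr 1; push_cast; ring
    have e2 : (i : ℝ) ^ (-(1 - p / 2)) * (i : ℝ) ^ (p / 2) = (i : ℝ) ^ (p - 1) := by
      rw [← Real.rpow_add hi0]
      congr 1; ring
    calc (1 - p) * degOf P.ep r i ω * P.degSet r (Finset.Icc 1 (i - 1)) ω / (2 * r ^ 2)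
        ≤ 1 * (2 * x * (r : ℝ) ^ (1 - p / 2) * (i : ℝ) ^ (-(1 - p / 2))) *
          (2 * x * (r : ℝ) ^ (1 - p / 2) * (2 / p * (i : ℝ) ^ (p / 2))) / (2 * r ^ 2) := by
          gcongr
          linarith
      _ = 4 / p * x ^ 2 * ((r : ℝ) ^ (1 - p / 2) * (r : ℝ) ^ (1 - p / 2) / r ^ 2) *
          ((i : ℝ) ^ (-(1 - p / 2)) * (i : ℝ) ^ (p / 2)) := by field_simp; ring
      _ = _ := by rw [e1, e2]
  have key := measureReal_le_exp P.ℱ (μ := P.μ) (s := 1) (t := n)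
    (X := P.edgeInc i (Finset.Icc 1 (i - 1)))
    (q := fun r ω => (1 - p) * degOf P.ep r i ω * P.degSet r (Finset.Icc 1 (i - 1)) ω /
      (2 * r ^ 2))
    (Y := fun r ω => ∑ s ∈ Finset.Ioc 1 r, P.edgeInc i (Finset.Icc 1 (i - 1)) s ω)
    (g := fun r => (P.degBounded x n r).indicator fun _ => 1)
    (l := fun _ => 1 / 4)
    (k := fun r => 3 / 8 * (4 / p * x ^ 2 * (r : ℝ) ^ (-p) * (i : ℝ) ^ (p - 1))) (C := 0)
    (A := {ω | ω ∈ P.degBounded x n n ∧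
        z ≤ ∑ s ∈ Finset.Ioc 1 n, P.edgeInc i (Finset.Icc 1 (i - 1)) s ω}) (z := z / 4)
    (fun r _ => P.measurable_edgeInc _ _ _) (fun r _ => P.edgeInc_nonneg _ _ _)
    (fun r _ => P.edgeInc_le_two _ _ _) (fun r hr => P.condExp_edgeInc hr _ _)
    (fun ω => by simp)
    (fun r hr ω => by
      rw [← Finset.insert_Ioc_right_eq_Ioc_add_one hr, Finset.sum_insert (by simp)]; ring)
    (fun r _ => measurable_const.indicator (P.measurableSet_degBounded x n r))
    (fun r _ => Set.indicator_nonneg fun _ _ => zero_le_one)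
    (fun r _ => Set.indicator_le_self' fun _ _ => zero_le_one)
    (fun r _ => Set.indicator_le_indicator_of_subset (P.degBounded_antitone x n r.le_succ)
      fun _ => zero_le_one)
    (fun _ _ => by norm_num [abs_of_pos]) ?_ (hi.trans hin)
    (fun ω hω => Set.indicator_of_mem hω.1 _) ?_
  · refine key.trans (Real.exp_le_exp.2 ?_)
    rw [mul_zero, add_zero, sub_le_sub_iff_right]
    have h1 : ∑ r ∈ Finset.Ico 1 n, (r : ℝ) ^ (-p) ≤ (n : ℝ) ^ (1 - p) / (1 - p) := by
      refine le_trans (Finset.sum_le_sum_of_subset_of_nonneg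
        (fun r hr => ?_) fun _ _ _ => by positivity)
        ((Finset.sum_congr rfl fun r _ => by congr 1; ring).trans_le
          (sum_rpow_neg_le (y := 1 - p) (by linarith) (by linarith) n))
      rw [Finset.mem_Ico] at hr
      exact Finset.mem_Icc.2 ⟨hr.1, hr.2.le⟩
    rw [Real.div_rpow (by positivity) hi0.le]
    have h2 : (i : ℝ) ^ (p - 1) = ((i : ℝ) ^ (1 - p))⁻¹ := by
      rw [← Real.rpow_neg hi0.le, neg_sub]
    have hi1 : (0 : ℝ) < (i : ℝ) ^ (1 - p) := by positivity
    calc ∑ r ∈ Finset.Ico 1 n, 3 / 8 * (4 / p * x ^ 2 * (r : ℝ) ^ (-p) * (i : ℝ) ^ (p - 1))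
        = 3 / (2 * p) * x ^ 2 * (i : ℝ) ^ (p - 1) * ∑ r ∈ Finset.Ico 1 n, (r : ℝ) ^ (-p) := by
          rw [Finset.mul_sum]
          refine Finset.sum_congr rfl fun r _ => ?_
          field_simp
          ring
      _ ≤ 3 / (2 * p) * x ^ 2 * (i : ℝ) ^ (p - 1) * ((n : ℝ) ^ (1 - p) / (1 - p)) := by
          gcongr
      _ = _ := by
          have : 1 - p ≠ 0 := by linarith
          rw [h2]
          field_simp
  · intro r hr ω hω
    have := hq r hr ω (Set.mem_of_indicator_ne_zero hω)
    linarith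
  · intro ω hω
    have := hω.2
    linarith

theorem measureReal_not_joined_le (hp1 : p ≤ 1) {D : ℝ} (hD : 0 ≤ D)
    {s t : ℕ} (hs : 1 ≤ s) (hst : s ≤ t) (i j : ℕ) :
    P.μ.real {ω | D ≤ (degOf P.ep s i ω : ℝ) ∧ D ≤ (degOf P.ep s j ω : ℝ) ∧
        ¬ P.Joined t i j ω} ≤
      Real.exp (-((1 - p) * D ^ 2 * (t - s) / (16 * t ^ 2))) := by
  have hG : MeasurableSet[P.ℱ s] {ω | D ≤ (degOf P.ep s i ω : ℝ) ∧
      D ≤ (degOf P.ep s j ω : ℝ)} :=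
    MeasurableSet.inter (P.measurable_degOf le_rfl i measurableSet_Ici)
      (P.measurable_degOf le_rfl j measurableSet_Ici)
  have key := measureReal_le_exp P.ℱ (μ := P.μ) (s := s) (t := t)
    (X := P.edgeInc i {j})
    (q := fun r ω => (1 - p) * degOf P.ep r i ω * P.degSet r {j} ω / (2 * r ^ 2))
    (Y := fun r ω => ∑ u ∈ Finset.Ioc s r, P.edgeInc i {j} u ω)
    (g := fun r => Set.indicator {ω | D ≤ (degOf P.ep s i ω : ℝ) ∧
      D ≤ (degOf P.ep s j ω : ℝ)} fun _ => 1)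
    (l := fun _ => -(1 / 4))
    (k := fun r => -((1 - p) * D ^ 2 / (16 * r ^ 2))) (C := 0)
    (A := {ω | D ≤ (degOf P.ep s i ω : ℝ) ∧ D ≤ (degOf P.ep s j ω : ℝ) ∧
        ¬ P.Joined t i j ω}) (z := 0)
    (fun r _ => P.measurable_edgeInc _ _ _) (fun r _ => P.edgeInc_nonneg _ _ _)
    (fun r _ => P.edgeInc_le_two _ _ _) (fun r hr => P.condExp_edgeInc (hs.trans hr) _ _)
    (fun ω => by simp)
    (fun r hr ω => by
      rw [← Finset.insert_Ioc_right_eq_Ioc_add_one hr, Finset.sum_insert (by simp)]; ring)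
    (fun r hr => measurable_const.indicator (P.ℱ.mono hr _ hG))
    (fun r _ => Set.indicator_nonneg fun _ _ => zero_le_one)
    (fun r _ => Set.indicator_le_self' fun _ _ => zero_le_one)
    (fun r _ _ => le_rfl)
    (fun _ _ => by norm_num [abs_of_pos]) ?_ hst
    (fun ω hω => Set.indicator_of_mem (show ω ∈ {ω | D ≤ (degOf P.ep s i ω : ℝ) ∧
      D ≤ (degOf P.ep s j ω : ℝ)} from ⟨hω.1, hω.2.1⟩) _) ?_
  · refine key.trans (Real.exp_le_exp.2 ?_)
    rw [mul_zero, add_zero, sub_zero, Finset.sum_neg_distrib, neg_le_neg_iff]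
    calc (1 - p) * D ^ 2 * (t - s) / (16 * t ^ 2)
        = ∑ r ∈ Finset.Ico s t, (1 - p) * D ^ 2 / (16 * t ^ 2) := by
          rw [Finset.sum_const, Nat.card_Ico, nsmul_eq_mul, Nat.cast_sub hst]
          ring
      _ ≤ _ := by
          refine Finset.sum_le_sum fun r hr => ?_
          rw [Finset.mem_Ico] at hr
          have hr0 : (0 : ℝ) < r := by exact_mod_cast hs.trans hr.1
          have hrt : (r : ℝ) ≤ t := by exact_mod_cast hr.2.le
          have : 0 ≤ 1 - p := by linarith
          gcongr
  · intro r hr ω hω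
    obtain ⟨h1, h2⟩ := Set.mem_of_indicator_ne_zero hω
    have h3 : (degOf P.ep s i ω : ℝ) ≤ degOf P.ep r i ω := by exact_mod_cast P.degOf_mono hr i ω
    have h4 : (degOf P.ep s j ω : ℝ) ≤ degOf P.ep r j ω := by exact_mod_cast P.degOf_mono hr j ω
    have h5 : 0 ≤ 1 - p := by linarith
    have hr0 : (0 : ℝ) < r := by exact_mod_cast hs.trans hr
    have h6 : (1 - p) * D * D / (2 * r ^ 2) ≤
        (1 - p) * degOf P.ep r i ω * P.degSet r {j} ω / (2 * r ^ 2) := by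
      rw [P.degSet_singleton]
      gcongr <;> linarith
    have h7 : (1 - p) * D ^ 2 / (16 * r ^ 2) = 1 / 8 * ((1 - p) * D * D / (2 * r ^ 2)) := by
      field_simp
      ring
    rw [h7]
    linarith
  · intro ω hω
    have h1 : ∑ u ∈ Finset.Ioc s t, P.edgeInc i {j} u ω = 0 := by
      refine Finset.sum_eq_zero fun u hu => ?_
      rw [Finset.mem_Ioc] at hu
      have h2 : ¬ (P.ep u ω = (i, j) ∨ P.ep u ω = (j, i)) := fun h =>
        hω.2.2 ⟨u, Finset.mem_Icc.2 ⟨by omega, hu.2⟩, h⟩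
      rw [not_or, Prod.ext_iff, Prod.ext_iff] at h2
      simp only [edgeInc, edgeInd, Pi.add_apply, Set.indicator, Set.mem_ofPred_eq,
        Finset.mem_singleton]
      rw [if_neg fun h => h2.1 h.2, if_neg fun h => h2.2 h.2, add_zero]
    rw [h1, mul_zero]

theorem card_clique_le {t : ℕ} {ω : P.Ω} {S : Finset ℕ} {i : ℕ} (hi : i ∈ S)
    (hS1 : ∀ j ∈ S, 1 ≤ j) (hmax : ∀ j ∈ S, j ≤ i)
    (hS : ∀ j ∈ S, j ≠ i → P.Joined t i j ω) :
    (S.card : ℝ) ≤ 2 + ∑ s ∈ Finset.Ioc 1 t, P.edgeInc i (Finset.Icc 1 (i - 1)) s ω := by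
  set W := Finset.Icc 1 (i - 1)
  set C₁ := (Finset.Ioc 1 t).filter fun s => 1 ≤ P.edgeInc i W s ω
  set C₂ := (Finset.Ioc 1 t).filter fun s => P.Z s ω = true ∧ (P.ep s ω).2 = i
  have hC₁ : (C₁.card : ℝ) ≤ ∑ s ∈ Finset.Ioc 1 t, P.edgeInc i W s ω := by
    calc (C₁.card : ℝ) = ∑ s ∈ C₁, 1 := by simp
      _ ≤ ∑ s ∈ C₁, P.edgeInc i W s ω :=
          Finset.sum_le_sum fun s hs => (Finset.mem_filter.1 hs).2
      _ ≤ _ := Finset.sum_le_sum_of_subset_of_nonneg (Finset.filter_subset _ _)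
          fun s _ _ => P.edgeInc_nonneg _ _ _ _
  have hC₂ : C₂.card ≤ 1 := by
    have hlt : ∀ s ∈ C₂, ∀ s' ∈ C₂, ¬ s < s' := by
      intro s hs s' hs' h
      simp only [C₂, Finset.mem_filter, Finset.mem_Ioc] at hs hs'
      obtain ⟨u, rfl⟩ : ∃ u, s = u + 1 := ⟨s - 1, by omega⟩
      obtain ⟨u', rfl⟩ : ∃ u', s' = u' + 1 := ⟨s' - 1, by omega⟩
      have h1 := (P.ep_vertexStep u (by omega) ω hs.2.1).1
      have h2 := (P.ep_vertexStep u' (by omega) ω hs'.2.1).1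
      have h3 := P.nv_succ u (by omega) ω
      rw [hs.2.1, if_pos rfl] at h3
      have h4 := P.nv_mono (s := u + 1) (t := u') (by omega) (by omega) ω
      omega
    refine Finset.card_le_one.2 fun s hs s' hs' => ?_
    have h1 := hlt s hs s' hs'
    have h2 := hlt s' hs' s hs
    omega
  have hsub : S.erase i ⊆ (C₁ ∪ C₂).image
      fun s => if (P.ep s ω).1 = i then (P.ep s ω).2 else (P.ep s ω).1 := by
    intro j hj
    obtain ⟨hji, hjS⟩ := Finset.mem_erase.1 hj
    have hj1 := hS1 j hjS
    have hjlt : j < i := lt_of_le_of_ne (hmax j hjS) hji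
    obtain ⟨s, hs, hep⟩ := hS j hjS hji
    rw [Finset.mem_Icc] at hs
    have hs1 : 1 < s := by
      by_contra h
      obtain rfl : s = 1 := by omega
      rw [P.ep_one] at hep
      simp only [Prod.ext_iff] at hep
      omega
    rw [Finset.mem_image]
    refine ⟨s, ?_, ?_⟩
    · have hsI : s ∈ Finset.Ioc 1 t := Finset.mem_Ioc.2 ⟨hs1, hs.2⟩
      rw [Finset.mem_union]
      cases hZ : P.Z s ω with
      | true =>
        right
        refine Finset.mem_filter.2 ⟨hsI, hZ, ?_⟩
        obtain ⟨u, rfl⟩ : ∃ u, s = u + 1 := ⟨s - 1, by omega⟩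
        have h1 := P.ep_vertexStep u (by omega) ω hZ
        rcases hep with h | h <;> rw [h] at h1 ⊢
        simp only at h1
        omega
      | false =>
        left
        refine Finset.mem_filter.2 ⟨hsI, ?_⟩
        have hjW : j ∈ W := Finset.mem_Icc.2 ⟨hj1, by omega⟩
        have h1 := P.edgeInd_nonneg {i} W s ω
        have h2 := P.edgeInd_nonneg W {i} s ω
        rcases hep with h | h
        · have h3 : P.edgeInd {i} W s ω = 1 :=
            Set.indicator_of_mem (by simp [hZ, h, hjW]) _
          rw [edgeInc, Pi.add_apply]
          linarith
        · have h3 : P.edgeInd W {i} s ω = 1 :=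
            Set.indicator_of_mem (by simp [hZ, h, hjW]) _
          rw [edgeInc, Pi.add_apply]
          linarith
    · rcases hep with h | h <;> simp [h, hji]
  have hcard := (Finset.card_le_card hsub).trans
    (Finset.card_image_le.trans (Finset.card_union_le _ _))
  rw [Finset.card_erase_of_mem hi] at hcard
  have h1 : S.card ≤ 2 + C₁.card := by omega
  have h2 : (S.card : ℝ) ≤ 2 + C₁.card := by exact_mod_cast h1
  linarith

end PAProcess
theorem sum_rpow_sub_one_le {y : ℝ} (hy0 : 0 < y) (hy1 : y ≤ 1) {S : Finset ℕ}
    (hS : ∀ j ∈ S, 1 ≤ j) {K : ℝ} (hK : 0 < K) (hcard : (S.card : ℝ) ≤ K) :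
    ∑ j ∈ S, (j : ℝ) ^ (y - 1) ≤ K ^ y * (1 / y + 1) := by
  have h1 : ∑ j ∈ S with j ≤ ⌊K⌋₊, (j : ℝ) ^ (y - 1) ≤ K ^ y / y := by
    calc ∑ j ∈ S with j ≤ ⌊K⌋₊, (j : ℝ) ^ (y - 1)
        ≤ ∑ j ∈ Finset.Icc 1 ⌊K⌋₊, (j : ℝ) ^ (y - 1) := by
          refine Finset.sum_le_sum_of_subset_of_nonneg (fun j hj => ?_) fun j _ _ => by positivity
          rw [Finset.mem_filter] at hj
          exact Finset.mem_Icc.2 ⟨hS j hj.1, hj.2⟩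
      _ ≤ (⌊K⌋₊ : ℝ) ^ y / y := sum_rpow_neg_le hy0 hy1 _
      _ ≤ K ^ y / y := by
          have := Nat.floor_le hK.le
          gcongr
  have h2 : ∑ j ∈ S with ¬ j ≤ ⌊K⌋₊, (j : ℝ) ^ (y - 1) ≤ K ^ y := by
    calc ∑ j ∈ S with ¬ j ≤ ⌊K⌋₊, (j : ℝ) ^ (y - 1)
        ≤ ∑ j ∈ S with ¬ j ≤ ⌊K⌋₊, K ^ (y - 1) := by
          refine Finset.sum_le_sum fun j hj => ?_
          have h := Nat.lt_of_floor_lt (not_le.1 (Finset.mem_filter.1 hj).2)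
          exact Real.rpow_le_rpow_of_nonpos hK h.le (by linarith)
      _ ≤ S.card * K ^ (y - 1) := by
          rw [Finset.sum_const, nsmul_eq_mul]
          gcongr
          exact Finset.filter_subset _ _
      _ ≤ K * K ^ (y - 1) := by gcongr
      _ = K ^ y := by rw [Real.rpow_sub_one hK.ne']; field_simp
  rw [← Finset.sum_filter_add_sum_filter_not S (· ≤ ⌊K⌋₊)]
  calc _ ≤ K ^ y / y + K ^ y := add_le_add h1 h2
    _ = _ := by ring

namespace PAProcess

variable {p : ℝ} (P : PAProcess p)

theorem bddAbove_cliqueCards (t : ℕ) (ω : P.Ω) :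
    BddAbove {k | ∃ S : Finset ℕ, S ⊆ Finset.Icc 1 (P.nv t ω) ∧ S.card = k ∧
      ∀ i ∈ S, ∀ j ∈ S, i ≠ j → P.Joined t i j ω} := by
  refine ⟨P.nv t ω, ?_⟩
  rintro _ ⟨S, hS, rfl, -⟩
  simpa using Finset.card_le_card hS

theorem card_le_cliqueNum {t : ℕ} {ω : P.Ω} {S : Finset ℕ} (hS : S ⊆ Finset.Icc 1 (P.nv t ω))
    (hjoin : ∀ i ∈ S, ∀ j ∈ S, i ≠ j → P.Joined t i j ω) : S.card ≤ P.cliqueNum t ω :=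
  le_csSup (P.bddAbove_cliqueCards t ω) ⟨S, hS, rfl, hjoin⟩

theorem exists_card_eq_cliqueNum (t : ℕ) (ω : P.Ω) :
    ∃ S : Finset ℕ, S ⊆ Finset.Icc 1 (P.nv t ω) ∧ S.card = P.cliqueNum t ω ∧
      ∀ i ∈ S, ∀ j ∈ S, i ≠ j → P.Joined t i j ω := by
  refine Nat.sSup_mem ?_ (P.bddAbove_cliqueCards t ω)
  exact ⟨0, ∅, by simp⟩

theorem measureReal_cliqueNum_gt_le (hp0 : 0 < p) (hp1 : p < 1) {x : ℝ} (hx : 0 ≤ x) {t : ℕ}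
    (ht : 1 ≤ t) {b k : ℝ} (hb : 0 < b) (hbk : b ≤ k) :
    P.μ.real {ω | k < (P.cliqueNum t ω : ℝ)} ≤ (t : ℝ) ^ 2 * Real.exp (1 / 2 - x / 8) +
      t * Real.exp (3 / (2 * p * (1 - p)) * x ^ 2 * ((t : ℝ) / b) ^ (1 - p) - (k - 2) / 4) := by
  set I := (Finset.Icc 1 t).filter fun i : ℕ => b ≤ (i : ℝ)
  set A : ℕ → Set P.Ω := fun i => {ω | ω ∈ P.degBounded x t t ∧
    k - 2 ≤ ∑ s ∈ Finset.Ioc 1 t, P.edgeInc i (Finset.Icc 1 (i - 1)) s ω}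
  have hsub : {ω | k < (P.cliqueNum t ω : ℝ)} ⊆ (P.degBounded x t t)ᶜ ∪ ⋃ i ∈ I, A i := by
    intro ω (hω : k < (P.cliqueNum t ω : ℝ))
    by_cases hdeg : ω ∈ P.degBounded x t t
    swap
    · exact Or.inl hdeg
    right
    obtain ⟨S, hS, hcard, hjoin⟩ := P.exists_card_eq_cliqueNum t ω
    have hne : S.Nonempty := by
      rw [← Finset.card_pos, hcard]
      exact_mod_cast (hb.trans_le hbk).trans hω
    have hi := S.max'_mem hne
    set i := S.max' hne
    have hSi : S ⊆ Finset.Icc 1 i := fun j hj =>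
      Finset.mem_Icc.2 ⟨(Finset.mem_Icc.1 (hS hj)).1, S.le_max' j hj⟩
    have hiS : S.card ≤ i := by simpa using Finset.card_le_card hSi
    have hit := (Finset.mem_Icc.1 (hS hi)).2.trans (P.nv_le ht ω)
    have hcl := P.card_clique_le hi (fun j hj => (Finset.mem_Icc.1 (hSi hj)).1)
      (fun j hj => (Finset.mem_Icc.1 (hSi hj)).2) fun j hj hji => hjoin i hi j hj hji.symm
    rw [← hcard] at hω
    simp only [Set.mem_iUnion]
    refine ⟨i, Finset.mem_filter.2 ⟨Finset.mem_Icc.2 ⟨(Finset.mem_Icc.1 (hSi hi)).1, hit⟩, ?_⟩,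
      hdeg, by linarith⟩
    have : (S.card : ℝ) ≤ i := by exact_mod_cast hiS
    linarith
  have h1p : 0 < 1 - p := by linarith
  refine (measureReal_mono hsub (measure_ne_top _ _)).trans ((measureReal_union_le _ _).trans
    (add_le_add (P.measureReal_compl_degBounded_le hp1.le hx t) ?_))
  calc P.μ.real (⋃ i ∈ I, A i) ≤ ∑ i ∈ I, P.μ.real (A i) := measureReal_biUnion_finset_le _ _
    _ ≤ ∑ i ∈ I, Real.exp
          (3 / (2 * p * (1 - p)) * x ^ 2 * ((t : ℝ) / b) ^ (1 - p) - (k - 2) / 4) := by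
        refine Finset.sum_le_sum fun i hi => ?_
        obtain ⟨hi1, hbi⟩ := Finset.mem_filter.1 hi
        rw [Finset.mem_Icc] at hi1
        refine (P.measureReal_edgeInc_ge_le hp0 hp1 hx hi1.1 hi1.2 _).trans ?_
        gcongr
    _ ≤ _ := by
        rw [Finset.sum_const, nsmul_eq_mul]
        gcongr
        calc I.card ≤ (Finset.Icc 1 t).card := Finset.card_filter_le _ _
          _ = t := by simp

theorem measureReal_cliqueNum_lt_le (hp0 : 0 < p) (hp1 : p < 1) {x : ℝ} (hx : 0 ≤ x)
    {s r t : ℕ} (hs : 1 ≤ s) (hsr : s ≤ r) (hrt : r ≤ t) {K D : ℝ} (hK : 0 < K)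
    (hD : D = growth (1 - p / 2) r / (4 * growth (1 - p / 2) s))
    (hKs : 4 * x * (K ^ (p / 2) * (1 / (p / 2) + 1)) * growth (1 - p / 2) s < s) :
    P.μ.real {ω | (P.cliqueNum t ω : ℝ) < K} ≤ (t : ℝ) ^ 2 * Real.exp (1 / 2 - x / 8) +
      (Real.exp (-(s / 8)) +
        (s : ℝ) ^ 2 * Real.exp (-((1 - p) * D ^ 2 * (t - r) / (16 * t ^ 2)))) := by
  have hc0 : 0 ≤ 1 - p / 2 := by linarith
  have hc1 : 1 - p / 2 ≤ 1 := by linarith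
  have hs0 := growth_pos hc0 s
  have hr0 := growth_pos hc0 r
  have hD0 : 0 < D := by rw [hD]; positivity
  set J := Finset.Icc 1 s ×ˢ Finset.Icc 1 s
  set B : Set P.Ω := {ω | P.degSet r (Finset.Icc 1 s) ω ≤
    s * growth (1 - p / 2) r / (2 * growth (1 - p / 2) s)}
  set A : ℕ × ℕ → Set P.Ω := fun e => {ω | D ≤ (degOf P.ep r e.1 ω : ℝ) ∧
    D ≤ (degOf P.ep r e.2 ω : ℝ) ∧ ¬ P.Joined t e.1 e.2 ω}
  have hsub : {ω | (P.cliqueNum t ω : ℝ) < K} ⊆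
      (P.degBounded x t t)ᶜ ∪ (B ∪ ⋃ e ∈ J, A e) := by
    intro ω (hω : (P.cliqueNum t ω : ℝ) < K)
    by_contra hgood
    simp only [Set.mem_union, not_or, Set.mem_compl_iff, not_not, Set.mem_iUnion, not_exists]
      at hgood
    obtain ⟨hdeg, hB, hA⟩ := hgood
    have hB : s * growth (1 - p / 2) r / (2 * growth (1 - p / 2) s) <
      P.degSet r (Finset.Icc 1 s) ω := not_le.1 hB
    set H := (Finset.Icc 1 s).filter fun j => D ≤ (degOf P.ep r j ω : ℝ)
    have hHs : ∀ j ∈ H, 1 ≤ j ∧ j ≤ s := fun j hj => Finset.mem_Icc.1 (Finset.mem_filter.1 hj).1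
    have hHD : ∀ j ∈ H, D ≤ (degOf P.ep r j ω : ℝ) := fun j hj => (Finset.mem_filter.1 hj).2
    have hcard : (H.card : ℝ) < K := by
      refine lt_of_le_of_lt ?_ hω
      refine Nat.cast_le.2 (P.card_le_cliqueNum (fun j hj => ?_) fun i hi j hj hij => ?_)
      · have hpos : 0 < degOf P.ep r j ω := by exact_mod_cast hD0.trans_le (hHD j hj)
        have h1 := P.le_nv_of_degOf_pos hpos
        exact Finset.mem_Icc.2 ⟨h1.1, h1.2.trans (P.nv_mono (hs.trans hsr) hrt ω)⟩
      · by_contra hj'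
        exact hA (i, j) (Finset.mem_product.2 ⟨Finset.mem_Icc.2 (hHs i hi),
          Finset.mem_Icc.2 (hHs j hj)⟩) ⟨hHD i hi, hHD j hj, hj'⟩
    have hHsum : ∑ j ∈ H, (degOf P.ep r j ω : ℝ) ≤
        x * growth (1 - p / 2) r * (K ^ (p / 2) * (1 / (p / 2) + 1)) := by
      calc ∑ j ∈ H, (degOf P.ep r j ω : ℝ)
          ≤ ∑ j ∈ H, x * growth (1 - p / 2) r * (j : ℝ) ^ (p / 2 - 1) := by
            refine Finset.sum_le_sum fun j hj => ?_
            obtain ⟨hj1, hjs⟩ := hHs j hj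
            have hj0 : (0 : ℝ) < j := by exact_mod_cast hj1
            refine (hdeg r (Finset.mem_Icc.2 ⟨hs.trans hsr, hrt⟩) j
              (Finset.mem_Icc.2 ⟨hj1, hjs.trans (hsr.trans hrt)⟩)).trans ?_
            rw [div_eq_mul_inv, show p / 2 - 1 = -(1 - p / 2) by ring, Real.rpow_neg hj0.le]
            have := rpow_le_growth hc0 hc1 hj1
            gcongr
        _ ≤ _ := by
            rw [← Finset.mul_sum]
            gcongr
            exact sum_rpow_sub_one_le (by linarith) (by linarith) (fun j hj => (hHs j hj).1) hK
              hcard.le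
    have hrest : ∑ j ∈ Finset.Icc 1 s with ¬ D ≤ (degOf P.ep r j ω : ℝ),
        (degOf P.ep r j ω : ℝ) ≤ s * D := by
      calc _ ≤ ∑ j ∈ Finset.Icc 1 s with ¬ D ≤ (degOf P.ep r j ω : ℝ), D :=
            Finset.sum_le_sum fun j hj => (not_le.1 (Finset.mem_filter.1 hj).2).le
        _ ≤ _ := by
            rw [Finset.sum_const, nsmul_eq_mul]
            gcongr
            calc _ ≤ (Finset.Icc 1 s).card := Finset.card_filter_le _ _
              _ = s := by simp
    have hsplit : P.degSet r (Finset.Icc 1 s) ω =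
        ∑ j ∈ H, (degOf P.ep r j ω : ℝ) +
          ∑ j ∈ Finset.Icc 1 s with ¬ D ≤ (degOf P.ep r j ω : ℝ), (degOf P.ep r j ω : ℝ) :=
      (Finset.sum_filter_add_sum_filter_not _ _ _).symm
    have hsD : s * growth (1 - p / 2) r / (2 * growth (1 - p / 2) s) = 2 * (s * D) := by
      rw [hD]; field_simp; ring
    have hlt : x * growth (1 - p / 2) r * (K ^ (p / 2) * (1 / (p / 2) + 1)) < s * D := by
      calc x * growth (1 - p / 2) r * (K ^ (p / 2) * (1 / (p / 2) + 1))
          = 4 * x * (K ^ (p / 2) * (1 / (p / 2) + 1)) * growth (1 - p / 2) s * D := by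
            rw [hD]
            generalize growth (1 - p / 2) s = a at hs0 ⊢
            field_simp
        _ < s * D := mul_lt_mul_of_pos_right hKs hD0
    linarith
  refine (measureReal_mono hsub (measure_ne_top _ _)).trans ((measureReal_union_le _ _).trans
    (add_le_add (P.measureReal_compl_degBounded_le hp1.le hx t)
    ((measureReal_union_le _ _).trans (add_le_add (P.measureReal_degSet_le hp1.le hs hsr) ?_))))
  calc P.μ.real (⋃ e ∈ J, A e) ≤ ∑ e ∈ J, P.μ.real (A e) := measureReal_biUnion_finset_le _ _
    _ ≤ ∑ e ∈ J, Real.exp (-((1 - p) * D ^ 2 * (t - r) / (16 * t ^ 2))) :=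
        Finset.sum_le_sum fun e _ =>
          P.measureReal_not_joined_le hp1.le hD0.le (hs.trans hsr) hrt e.1 e.2
    _ = _ := by
        rw [Finset.sum_const, nsmul_eq_mul, Finset.card_product, Nat.card_Icc,
          Nat.add_sub_cancel]
        push_cast
        ring

end PAProcess
theorem eventually_mul_log_le_rpow (C : ℝ) {η : ℝ} (hη : 0 < η) :
    ∀ᶠ t : ℕ in atTop, C * Real.log t ≤ (t : ℝ) ^ η := by
  have h := ((isLittleO_log_rpow_atTop hη).const_mul_left C).bound one_pos
  filter_upwards [tendsto_natCast_atTop_atTop.eventually h] with t ht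
  rw [one_mul, Real.norm_of_nonneg (by positivity : (0 : ℝ) ≤ (t : ℝ) ^ η)] at ht
  exact (le_abs_self _).trans ht

theorem eventually_le_rpow (C : ℝ) {η : ℝ} (hη : 0 < η) :
    ∀ᶠ t : ℕ in atTop, C ≤ (t : ℝ) ^ η :=
  ((tendsto_rpow_atTop hη).comp tendsto_natCast_atTop_atTop).eventually_ge_atTop C

theorem eventually_le_log (C : ℝ) : ∀ᶠ t : ℕ in atTop, C ≤ Real.log t :=
  (Real.tendsto_log_atTop.comp tendsto_natCast_atTop_atTop).eventually_ge_atTop C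

theorem sq_mul_exp_sub_log {t : ℝ} (ht : 0 < t) (a : ℝ) :
    t ^ 2 * Real.exp (a - 24 * Real.log t / 8) = Real.exp a / t := by
  rw [show a - 24 * Real.log t / 8 = a - 3 * Real.log t by ring, Real.exp_sub,
    show (3 : ℝ) * Real.log t = ((3 : ℕ) : ℝ) * Real.log t by norm_num, Real.exp_nat_mul,
    Real.exp_log ht]
  field_simp

theorem rpow_le_sq_growth_div {p : ℝ} (hp0 : 0 ≤ p) (hp1 : p ≤ 1) {s r : ℕ} (hs : 1 ≤ s)
    (hsr : s ≤ r) {u : ℝ} (hu : 0 ≤ u) (hur : u / 6 ≤ r / s) :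
    u ^ (2 - p) / (64 * 36) ≤ (growth (1 - p / 2) r / (4 * growth (1 - p / 2) s)) ^ 2 := by
  have hc0 : 0 ≤ 1 - p / 2 := by linarith
  have hc1 : 1 - p / 2 ≤ 1 := by linarith
  have hs0 : (0 : ℝ) < s := by exact_mod_cast hs
  have hgs := growth_pos hc0 s
  have hgr := growth_pos hc0 r
  have h2 : ((r : ℝ) / s) ^ (1 - p / 2) / 8 ≤
      growth (1 - p / 2) r / (4 * growth (1 - p / 2) s) := by
    rw [Real.div_rpow (by positivity) hs0.le, div_div,
      div_le_div_iff₀ (by positivity) (by positivity)]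
    have h3 := rpow_le_growth hc0 hc1 (hs.trans hsr)
    have h4 := growth_le_rpow hc0 hc1 hs
    calc (r : ℝ) ^ (1 - p / 2) * (4 * growth (1 - p / 2) s)
        ≤ growth (1 - p / 2) r * (4 * (2 * (s : ℝ) ^ (1 - p / 2))) := by gcongr
      _ = _ := by ring
  have h5 : (6 : ℝ) ^ (2 - p) ≤ 36 := by
    calc (6 : ℝ) ^ (2 - p) ≤ (6 : ℝ) ^ (2 : ℝ) :=
          Real.rpow_le_rpow_of_exponent_le (by norm_num) (by linarith)
      _ = 36 := by norm_num
  calc u ^ (2 - p) / (64 * 36) ≤ u ^ (2 - p) / (64 * (6 : ℝ) ^ (2 - p)) := by gcongr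
    _ = ((u / 6) ^ (1 - p / 2) / 8) ^ 2 := by
        rw [div_pow, ← Real.rpow_mul_natCast (by positivity), Nat.cast_ofNat,
          show (1 - p / 2) * 2 = 2 - p by ring, Real.div_rpow hu (by norm_num), div_div,
          mul_comm (64 : ℝ)]
        norm_num
    _ ≤ (((r : ℝ) / s) ^ (1 - p / 2) / 8) ^ 2 := by gcongr
    _ ≤ _ := by gcongr

namespace PAProcess

variable {p : ℝ} (P : PAProcess p)

theorem eventually_measureReal_cliqueNum_gt_le (hp0 : 0 < p) (hp1 : p < 1) :
    ∀ᶠ t : ℕ in atTop, P.μ.real {ω | (t : ℝ) ^ ((1 - p) / (2 - p)) * Real.log t ^ 3 <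
      (P.cliqueNum t ω : ℝ)} ≤ 2 * Real.exp (1 / 2) / t := by
  have h2p : 0 < 2 - p := by linarith
  have h1p : 0 < 1 - p := by linarith
  set b := (1 - p) / (2 - p) with hb
  have hb0 : 0 < b := by positivity
  set C := 3 / (2 * p * (1 - p))
  filter_upwards [eventually_ge_atTop 1, eventually_le_log 1,
    eventually_le_log (4 * (C * 24 ^ 2 + 2))] with t ht hL hL'
  have ht0 : (0 : ℝ) < t := by exact_mod_cast ht
  have ht1 : (1 : ℝ) ≤ t := by exact_mod_cast ht
  set L := Real.log t with hLdef
  have htb : 1 ≤ (t : ℝ) ^ b := Real.one_le_rpow ht1 hb0.le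
  have hpow : ((t : ℝ) / (t : ℝ) ^ b) ^ (1 - p) = (t : ℝ) ^ b := by
    nth_rewrite 1 [← Real.rpow_one (t : ℝ)]
    rw [← Real.rpow_sub ht0, ← Real.rpow_mul ht0.le]
    congr 1
    rw [hb]
    field_simp
    ring
  have hL3 : 1 ≤ L ^ 3 := one_le_pow₀ hL
  refine (P.measureReal_cliqueNum_gt_le hp0 hp1 (x := 24 * L) (by positivity) ht
    (b := (t : ℝ) ^ b) (by positivity) (le_mul_of_one_le_right (by positivity) hL3)).trans ?_
  rw [sq_mul_exp_sub_log ht0, hpow]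
  have hexp : C * (24 * L) ^ 2 * (t : ℝ) ^ b - ((t : ℝ) ^ b * L ^ 3 - 2) / 4 ≤
      1 / 2 - 2 * L := by
    have h1 : 1 ≤ (t : ℝ) ^ b * L := one_le_mul_of_one_le_of_one_le htb hL
    have h2 : L ≤ (t : ℝ) ^ b * L ^ 2 := by nlinarith
    have h3 : 0 ≤ (t : ℝ) ^ b * L ^ 2 := by positivity
    have h4 : (t : ℝ) ^ b * L ^ 2 * (C * 24 ^ 2 + 2 - L / 4) ≤ 0 :=
      mul_nonpos_of_nonneg_of_nonpos h3 (by linarith)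
    linarith
  calc _ ≤ Real.exp (1 / 2) / t + t * Real.exp (1 / 2 - 2 * L) := by gcongr
    _ = _ := by
        rw [Real.exp_sub, show (2 : ℝ) * L = ((2 : ℕ) : ℝ) * L by norm_num, Real.exp_nat_mul,
          hLdef, Real.exp_log ht0]
        field_simp
        ring

theorem eventually_measureReal_cliqueNum_lt_le (hp0 : 0 < p) (hp1 : p < 1) {ε : ℝ} (hε0 : 0 < ε)
    (hε1 : ε < 1) :
    ∀ᶠ t : ℕ in atTop, P.μ.real {ω | (P.cliqueNum t ω : ℝ) <
      (t : ℝ) ^ ((1 - ε) * (1 - p) / (2 - p))} ≤ (Real.exp (1 / 2) + 2) / t := by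
  have h2p : 0 < 2 - p := by linarith
  have h1p : 0 < 1 - p := by linarith
  have hc0 : 0 ≤ 1 - p / 2 := by linarith
  have hc1 : 1 - p / 2 ≤ 1 := by linarith
  have h1ε : 0 < 1 - ε / 2 := by linarith
  set k' := (1 - ε) * (1 - p) / (2 - p) with hk'
  set k := (1 - ε / 2) * (1 - p) / (2 - p) with hk
  have hk0 : 0 < k := by positivity
  have hk1 : k < 1 := by
    rw [hk, div_lt_one h2p]
    nlinarith
  have hkk' : 0 < (k - k') * (p / 2) := by
    have : k - k' = ε / 2 * ((1 - p) / (2 - p)) := by rw [hk, hk']; field_simp; ring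
    rw [this]
    positivity
  have hη : (1 - k) * (2 - p) - 1 = ε * (1 - p) / 2 := by rw [hk]; field_simp; ring
  have hη0 : 0 < (1 - k) * (2 - p) - 1 := by rw [hη]; positivity
  set M := 192 * (1 / (p / 2) + 1) with hM
  have hM0 : 0 < M := by positivity
  set N := 2 ^ 5 * 64 * 36 / (1 - p) with hN
  have hN0 : 0 < N := by positivity
  filter_upwards [eventually_ge_atTop 6, eventually_le_log 1,
    eventually_mul_log_le_rpow (2 * M) hkk', eventually_mul_log_le_rpow 8 hk0,
    eventually_le_rpow 6 (sub_pos.2 hk1), eventually_mul_log_le_rpow (3 * N) hη0]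
    with t ht hL hML h8L h6 hNL
  have ht0 : (0 : ℝ) < t := by positivity
  have ht1 : (1 : ℝ) ≤ t := by exact_mod_cast (by omega : 1 ≤ t)
  set L := Real.log t with hLdef
  set s := ⌈(t : ℝ) ^ k⌉₊ with hs
  set r := t / 2 with hr
  have htk : 1 ≤ (t : ℝ) ^ k := Real.one_le_rpow ht1 hk0.le
  have hs1 : (t : ℝ) ^ k ≤ s := Nat.le_ceil _
  have hs2 : (s : ℝ) ≤ 2 * (t : ℝ) ^ k := by
    have := Nat.ceil_lt_add_one (zero_le_one.trans htk)
    linarith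
  have hs0 : (0 : ℝ) < s := by linarith
  have hs_one : 1 ≤ s := by exact_mod_cast hs0
  have hr1 : (t : ℝ) / 3 ≤ r := by
    have : (t : ℝ) ≤ 3 * r := by exact_mod_cast (by omega : t ≤ 3 * r)
    linarith
  have hr2 : (t : ℝ) / 2 ≤ t - r := by
    have : 2 * (r : ℝ) ≤ t := by exact_mod_cast (by omega : 2 * r ≤ t)
    linarith
  have hdiv : (t : ℝ) ^ (1 - k) * (t : ℝ) ^ k = t := by
    rw [← Real.rpow_add ht0, sub_add_cancel, Real.rpow_one]
  have hsr : s ≤ r := by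
    have : (s : ℝ) ≤ r := by nlinarith
    exact_mod_cast this
  have hrt : r ≤ t := Nat.div_le_self _ _
  have hgs := growth_pos hc0 s
  have hgr := growth_pos hc0 r
  refine (P.measureReal_cliqueNum_lt_le hp0 hp1 (x := 24 * L) (by positivity) hs_one hsr hrt
    (K := (t : ℝ) ^ k') (by positivity) rfl ?_).trans ?_
  · have h1 : ((t : ℝ) ^ k') ^ (p / 2) * (t : ℝ) ^ ((k - k') * (p / 2)) ≤ (s : ℝ) ^ (p / 2) := by
      calc ((t : ℝ) ^ k') ^ (p / 2) * (t : ℝ) ^ ((k - k') * (p / 2))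
          = ((t : ℝ) ^ k) ^ (p / 2) := by
            rw [← Real.rpow_mul ht0.le, ← Real.rpow_mul ht0.le, ← Real.rpow_add ht0]
            ring_nf
        _ ≤ _ := by gcongr
    have h2 : M * L < (t : ℝ) ^ ((k - k') * (p / 2)) := by nlinarith
    have h3 : (s : ℝ) ^ (p / 2) * (s : ℝ) ^ (1 - p / 2) = s := by
      rw [← Real.rpow_add hs0, add_sub_cancel, Real.rpow_one]
    have h4 : 0 < ((t : ℝ) ^ k') ^ (p / 2) := by positivity
    calc 4 * (24 * L) * (((t : ℝ) ^ k') ^ (p / 2) * (1 / (p / 2) + 1)) * growth (1 - p / 2) s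
        ≤ 4 * (24 * L) * (((t : ℝ) ^ k') ^ (p / 2) * (1 / (p / 2) + 1)) *
          (2 * (s : ℝ) ^ (1 - p / 2)) := by
          gcongr
          exact growth_le_rpow hc0 hc1 hs_one
      _ = ((t : ℝ) ^ k') ^ (p / 2) * (M * L) * (s : ℝ) ^ (1 - p / 2) := by rw [hM]; ring
      _ < ((t : ℝ) ^ k') ^ (p / 2) * (t : ℝ) ^ ((k - k') * (p / 2)) * (s : ℝ) ^ (1 - p / 2) := by
          gcongr
      _ ≤ (s : ℝ) ^ (p / 2) * (s : ℝ) ^ (1 - p / 2) := by gcongr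
      _ = s := h3
  rw [sq_mul_exp_sub_log ht0]
  set D := growth (1 - p / 2) r / (4 * growth (1 - p / 2) s) with hD
  have hinv : Real.exp (-L) = 1 / t := by rw [Real.exp_neg, Real.exp_log ht0, one_div]
  have hB : Real.exp (-(s / 8)) ≤ 1 / t := by
    rw [← hinv]
    gcongr
    linarith
  have hDlow : (t : ℝ) ^ ((1 - k) * (2 - p)) / (64 * 36) ≤ D ^ 2 := by
    have h1 : (t : ℝ) ^ (1 - k) / 6 ≤ r / s := by
      rw [div_le_div_iff₀ (by norm_num) hs0]
      nlinarith [Real.rpow_nonneg ht0.le (1 - k)]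
    rw [Real.rpow_mul ht0.le]
    exact rpow_le_sq_growth_div hp0.le hp1.le hs_one hsr (by positivity) h1
  have hA : (s : ℝ) ^ 2 * Real.exp (-((1 - p) * D ^ 2 * (t - r) / (16 * t ^ 2))) ≤ 1 / t := by
    have hE : 3 * L ≤ (1 - p) * D ^ 2 * (t - r) / (16 * t ^ 2) := by
      calc 3 * L = 3 * N * L / N := by field_simp
        _ ≤ (t : ℝ) ^ ((1 - k) * (2 - p) - 1) / N := by gcongr
        _ = (1 - p) * ((t : ℝ) ^ ((1 - k) * (2 - p)) / (64 * 36)) * (t / 2) / (16 * t ^ 2) := by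
            rw [Real.rpow_sub_one ht0.ne', hN]
            generalize (t : ℝ) ^ ((1 - k) * (2 - p)) = u
            field_simp
            ring
        _ ≤ _ := by gcongr
    have hst : (s : ℝ) ≤ t := by exact_mod_cast hsr.trans hrt
    calc (s : ℝ) ^ 2 * Real.exp (-((1 - p) * D ^ 2 * (t - r) / (16 * t ^ 2)))
        ≤ (t : ℝ) ^ 2 * Real.exp (0 - 24 * L / 8) := by
          gcongr
          linarith
      _ = (1 : ℝ) / t := by rw [sq_mul_exp_sub_log ht0, Real.exp_zero]
  calc _ ≤ Real.exp (1 / 2) / t + (1 / t + 1 / t) := by gcongr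
    _ = _ := by ring

end PAProcess

/-- **Theorem (The clique number).**
For `p ∈ (0,1)` and every `0 < ε < 1`,
`P(t^{(1-ε)(1-p)/(2-p)} ≤ ω(G_t) ≤ t^{(1-p)/(2-p)} (log t)³) = 1 - o(1)` as `t → ∞`. -/
theorem clique_number (p : ℝ) (hp0 : 0 < p) (hp1 : p < 1)
    (P : PAProcess p) (ε : ℝ) (hε0 : 0 < ε) (hε1 : ε < 1) :
    Tendsto
      (fun t : ℕ => P.μ {ω |
        (t : ℝ) ^ ((1 - ε) * (1 - p) / (2 - p)) ≤ (P.cliqueNum t ω : ℝ) ∧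
        (P.cliqueNum t ω : ℝ) ≤ (t : ℝ) ^ ((1 - p) / (2 - p)) * Real.log t ^ 3})
      atTop (nhds 1) := by
  have hlim : Tendsto (fun t : ℕ => ENNReal.ofReal (1 - (3 * Real.exp (1 / 2) + 2) / t)) atTop
      (nhds 1) := by
    have h := (tendsto_const_div_atTop_nhds_zero_nat (3 * Real.exp (1 / 2) + 2)).const_sub 1
    rw [sub_zero] at h
    simpa using ENNReal.tendsto_ofReal h
  refine tendsto_of_tendsto_of_tendsto_of_le_of_le' hlim tendsto_const_nhds ?_
    (Eventually.of_forall fun t => prob_le_one)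
  filter_upwards [P.eventually_measureReal_cliqueNum_gt_le hp0 hp1,
    P.eventually_measureReal_cliqueNum_lt_le hp0 hp1 hε0 hε1] with t hgt hlt
  refine ENNReal.ofReal_le_of_le_toReal ?_
  set A : Set P.Ω := {ω | (P.cliqueNum t ω : ℝ) < (t : ℝ) ^ ((1 - ε) * (1 - p) / (2 - p))}
  set B : Set P.Ω := {ω | (t : ℝ) ^ ((1 - p) / (2 - p)) * Real.log t ^ 3 <
    (P.cliqueNum t ω : ℝ)}
  set G : Set P.Ω := {ω | (t : ℝ) ^ ((1 - ε) * (1 - p) / (2 - p)) ≤ (P.cliqueNum t ω : ℝ) ∧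
    (P.cliqueNum t ω : ℝ) ≤ (t : ℝ) ^ ((1 - p) / (2 - p)) * Real.log t ^ 3}
  have hcover : (Set.univ : Set P.Ω) ⊆ G ∪ (A ∪ B) := by
    intro ω _
    by_cases hA : ω ∈ A
    · exact Or.inr (Or.inl hA)
    by_cases hB : ω ∈ B
    · exact Or.inr (Or.inr hB)
    exact Or.inl ⟨not_lt.1 hA, not_lt.1 hB⟩
  have h1 : (1 : ℝ) ≤ P.μ.real G + (P.μ.real A + P.μ.real B) := by
    calc (1 : ℝ) = P.μ.real Set.univ := probReal_univ.symm
      _ ≤ P.μ.real (G ∪ (A ∪ B)) := measureReal_mono hcover (measure_ne_top _ _)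
      _ ≤ _ := (measureReal_union_le _ _).trans (by gcongr; exact measureReal_union_le _ _)
  have h2 : (3 * Real.exp (1 / 2) + 2) / (t : ℝ) =
      (Real.exp (1 / 2) + 2) / t + 2 * Real.exp (1 / 2) / t := by ring
  change _ ≤ P.μ.real G
  linarith
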